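/- arXiv:1404.0271 — 4 statements merged into one kernel-verified Lean document; each statement's English description precedes it below -/
import Mathlib

section
/- Let m ≥ 3 and k ≥ 0 be integers and α > 0 a real number, and write K = k(m+k−2). Then there exists exactly one function A : [0,∞) → ℝ that is infinitely differentiable on [0,∞) (with one-sided derivatives at 0), satisfies A(0) = 1, and satisfies the ordinary differential equation 4t²·A''(t) + 2(α + (m+6)t)·A'(t) + (3(m+1) − K)·A(t) = 0 for all t ∈ [0,∞). -/
section Aux

open MeasureTheory Set Filter Topology

/-- the Laplace-type integrand -/
noncomputable def kerI (β a b t s : ℝ) : ℝ := Real.exp (-s) * s ^ (a - 1) * (1 + β * t * s) ^ b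

/-- the Laplace-type integral -/
noncomputable def lapI (β a b t : ℝ) : ℝ := ∫ s in Ioi (0:ℝ), kerI β a b t s

lemma pow_bound (b C y s : ℝ) (hy : 0 ≤ y) (hyC : y ≤ C) (hs : 0 ≤ s) :
    (1 + y * s) ^ b ≤ (1 + 2 * (|b| + 1) * C) ^ (|b| + 1) * Real.exp (s / 2) := by
  set c := |b| + 1 with hc
  have hc0 : 0 < c := by positivity
  have hbc : b ≤ c := by have := le_abs_self b; linarith
  have hC : 0 ≤ C := hy.trans hyC
  have hys : 0 ≤ y * s := by positivity
  calc (1 + y * s) ^ b ≤ (1 + y * s) ^ c := Real.rpow_le_rpow_of_exponent_le (by linarith) hbc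
    _ ≤ ((1 + 2 * c * C) * Real.exp (s / (2 * c))) ^ c := by
        apply Real.rpow_le_rpow (by linarith) _ hc0.le
        have h1 : 1 + s / (2 * c) ≤ Real.exp (s / (2 * c)) := by
          have := Real.add_one_le_exp (s / (2 * c)); linarith
        have h2 : (1 + 2 * c * C) * (1 + s / (2 * c)) ≤ (1 + 2 * c * C) * Real.exp (s / (2 * c)) := by
          gcongr
        have h3 : (1 + 2 * c * C) * (1 + s / (2 * c)) = 1 + 2 * c * C + s / (2 * c) + C * s := by
          field_simp
          ring
        have h4 : y * s ≤ C * s := by gcongr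
        have h5 : 0 ≤ 2 * c * C := by positivity
        have h6 : 0 ≤ s / (2 * c) := by positivity
        linarith
    _ = (1 + 2 * c * C) ^ c * Real.exp (s / 2) := by
        rw [Real.mul_rpow (by positivity) (Real.exp_pos _).le, ← Real.exp_mul]
        congr 2
        field_simp

lemma kerI_nonneg {β a b t s : ℝ} (hβ : 0 < β) (ht : 0 ≤ t) (hs : 0 < s) : 0 ≤ kerI β a b t s := by
  unfold kerI; positivity

lemma kerI_bound {β a b t s T : ℝ} (hβ : 0 < β) (ht : 0 ≤ t) (htT : t ≤ T) (hs : 0 < s) :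
    ‖kerI β a b t s‖ ≤
      (1 + 2 * (|b| + 1) * (β * T)) ^ (|b| + 1) * (s ^ (a - 1) * Real.exp (-(1/2) * s ^ (1:ℝ))) := by
  rw [Real.norm_of_nonneg (kerI_nonneg hβ ht hs), kerI]
  have h := pow_bound b (β * T) (β * t) s (by positivity) (by gcongr) hs.le
  have he : Real.exp (-(1/2) * s ^ (1:ℝ)) = Real.exp (-s) * Real.exp (s / 2) := by
    rw [← Real.exp_add, Real.rpow_one]; congr 1; ring
  rw [he]
  calc _ ≤ Real.exp (-s) * s ^ (a - 1) *
      ((1 + 2 * (|b| + 1) * (β * T)) ^ (|b| + 1) * Real.exp (s / 2)) := by gcongr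
    _ = _ := by ring

lemma bound_integrable {a : ℝ} (ha : 0 < a) (M : ℝ) :
    Integrable (fun s : ℝ => M * (s ^ (a - 1) * Real.exp (-(1/2) * s ^ (1:ℝ))))
      (volume.restrict (Ioi 0)) :=
  (integrableOn_rpow_mul_exp_neg_mul_rpow (by linarith) (by norm_num) (by norm_num)).const_mul M

lemma kerI_meas (β a b t : ℝ) :
    AEStronglyMeasurable (kerI β a b t) (volume.restrict (Ioi 0)) := by
  unfold kerI
  apply Measurable.aestronglyMeasurable
  fun_prop

lemma kerI_integrable {β a b t : ℝ} (hβ : 0 < β) (ha : 0 < a) (ht : 0 ≤ t) :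
    IntegrableOn (kerI β a b t) (Ioi 0) := by
  apply (bound_integrable ha _).mono' (kerI_meas β a b t)
  filter_upwards [ae_restrict_mem measurableSet_Ioi] with s hs
  exact kerI_bound hβ ht le_rfl hs

lemma lapI_cont {β a b : ℝ} (hβ : 0 < β) (ha : 0 < a) : ContinuousOn (lapI β a b) (Ici 0) := by
  intro t ht
  have ht0 : 0 ≤ t := ht
  refine continuousWithinAt_of_dominated (F := fun t s => kerI β a b t s) (.of_forall fun t => kerI_meas β a b t) ?_
    (bound_integrable ha ((1 + 2 * (|b| + 1) * (β * (t + 1))) ^ (|b| + 1))) ?_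
  · filter_upwards [self_mem_nhdsWithin, mem_nhdsWithin_of_mem_nhds (Iio_mem_nhds (lt_add_one t))]
      with x hx hx1
    filter_upwards [ae_restrict_mem measurableSet_Ioi] with s hs
    exact kerI_bound hβ hx (le_of_lt hx1) hs
  · filter_upwards [ae_restrict_mem measurableSet_Ioi] with s hs
    have hs : 0 < s := hs
    apply ContinuousAt.continuousWithinAt
    unfold kerI
    apply ContinuousAt.mul continuousAt_const
    apply ContinuousAt.rpow_const (by fun_prop)
    left; positivity

lemma kerI_deriv {β a b t s : ℝ} (hβ : 0 < β) (ht : 0 ≤ t) (hs : 0 < s) :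
    HasDerivAt (fun t => kerI β a b t s) (b * β * kerI β (a + 1) (b - 1) t s) t := by
  unfold kerI
  have h1 : HasDerivAt (fun t : ℝ => 1 + β * t * s) (β * s) t := by
    have := (((hasDerivAt_id t).const_mul β).mul_const s).const_add 1
    simpa using this
  have h2 := (h1.rpow_const (p := b) (Or.inl (by positivity))).const_mul
    (Real.exp (-s) * s ^ (a - 1))
  refine h2.congr_deriv ?_
  have : s ^ (a + 1 - 1) = s ^ (a - 1) * s := by
    rw [← Real.rpow_add_one hs.ne']; congr 1; ring
  rw [this]; ring

lemma lapI_deriv_pos {β a b t : ℝ} (hβ : 0 < β) (ha : 0 < a) (ht : 0 < t) :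
    HasDerivAt (lapI β a b) (b * β * lapI β (a + 1) (b - 1) t) t := by
  have h := (hasDerivAt_integral_of_dominated_loc_of_deriv_le (μ := volume.restrict (Ioi (0:ℝ)))
    (F := fun t s => kerI β a b t s) (F' := fun t s => b * β * kerI β (a + 1) (b - 1) t s)
    (x₀ := t) (s := Ioo 0 (t + 1))
    (bound := fun s => |b * β| * ((1 + 2 * (|b - 1| + 1) * (β * (t + 1))) ^ (|b - 1| + 1) *
      (s ^ (a + 1 - 1) * Real.exp (-(1/2) * s ^ (1:ℝ)))))
    (Ioo_mem_nhds ht (by linarith)) (.of_forall fun t => kerI_meas β a b t)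
    (kerI_integrable hβ ha ht.le) ((kerI_meas β (a+1) (b-1) t).const_mul _) ?_ 
    ((bound_integrable (by linarith) _).const_mul _) ?_).2
  · rw [integral_const_mul] at h
    exact h
  · filter_upwards [ae_restrict_mem measurableSet_Ioi] with s hs x hx
    rw [norm_mul, Real.norm_eq_abs]
    gcongr
    exact kerI_bound hβ hx.1.le hx.2.le hs
  · filter_upwards [ae_restrict_mem measurableSet_Ioi] with s hs x hx
    exact kerI_deriv hβ hx.1.le hs

lemma lapI_deriv {β a b t : ℝ} (hβ : 0 < β) (ha : 0 < a) (ht : 0 ≤ t) :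
    HasDerivWithinAt (lapI β a b) (b * β * lapI β (a + 1) (b - 1) t) (Ici 0) t := by
  rcases ht.eq_or_lt with rfl | ht
  · refine hasDerivWithinAt_Ici_of_tendsto_deriv (s := Ioi 0) ?_ ?_ self_mem_nhdsWithin ?_
    · intro x hx
      exact (lapI_deriv_pos hβ ha hx).differentiableAt.differentiableWithinAt
    · exact (lapI_cont hβ ha 0 self_mem_Ici).mono Ioi_subset_Ici_self
    · have h : Tendsto (fun x => b * β * lapI β (a + 1) (b - 1) x) (𝓝[>] 0)
          (𝓝 (b * β * lapI β (a + 1) (b - 1) 0)) :=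
        (((lapI_cont (b := b - 1) hβ (by linarith : 0 < a + 1) 0 self_mem_Ici).mono
          Ioi_subset_Ici_self).tendsto).const_mul _
      refine h.congr' ?_
      filter_upwards [self_mem_nhdsWithin] with x hx
      exact (lapI_deriv_pos hβ ha hx).deriv.symm
  · exact (lapI_deriv_pos hβ ha ht).hasDerivWithinAt

lemma lapI_derivWithin {β a b t : ℝ} (hβ : 0 < β) (ha : 0 < a) (ht : t ∈ Ici (0:ℝ)) :
    derivWithin (lapI β a b) (Ici 0) t = b * β * lapI β (a + 1) (b - 1) t :=
  (lapI_deriv hβ ha ht).derivWithin (uniqueDiffOn_Ici 0 t ht)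

lemma lapI_contDiff_nat {β : ℝ} (hβ : 0 < β) (n : ℕ) :
    ∀ a b : ℝ, 0 < a → ContDiffOn ℝ n (lapI β a b) (Ici 0) := by
  induction n with
  | zero => intro a b ha; exact contDiffOn_zero.2 (lapI_cont hβ ha)
  | succ n ih =>
    intro a b ha
    push_cast
    rw [contDiffOn_succ_iff_derivWithin (uniqueDiffOn_Ici 0)]
    refine ⟨fun t ht => (lapI_deriv hβ ha ht).differentiableWithinAt, by simp, ?_⟩
    exact (contDiffOn_const.mul (ih (a + 1) (b - 1) (by linarith))).congr
      fun t ht => lapI_derivWithin hβ ha ht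

lemma lapI_pos {β a b t : ℝ} (hβ : 0 < β) (ha : 0 < a) (ht : 0 ≤ t) : 0 < lapI β a b t := by
  unfold lapI
  rw [setIntegral_pos_iff_support_of_nonneg_ae _ (kerI_integrable hβ ha ht)]
  · have : Function.support (kerI β a b t) ∩ Ioi 0 = Ioi 0 := by
      apply inter_eq_right.2
      intro s hs
      have hs : 0 < s := hs
      have : 0 < kerI β a b t s := by unfold kerI; positivity
      exact this.ne'
    rw [this]; simp
  · filter_upwards [ae_restrict_mem measurableSet_Ioi] with s hs
    exact kerI_nonneg hβ ht hs

lemma lapI_ode {β q b t : ℝ} (hβ : 0 < β) (hq : 0 < q) (ht : 0 ≤ t) :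
    t ^ 2 * (1 - b) * β ^ 2 * lapI β (q + 2) (b - 2) t
      - (1 + (q + 1 - b) * t * β) * lapI β (q + 1) (b - 1) t + q * lapI β q b t = 0 := by
  have i0 := kerI_integrable (b := b) hβ hq ht
  have i1 := kerI_integrable (b := b - 1) hβ (by linarith : 0 < q + 1) ht
  have i2 := kerI_integrable (b := b - 2) hβ (by linarith : 0 < q + 2) ht
  have j1 : Integrable (fun s => t ^ 2 * (1 - b) * β ^ 2 * kerI β (q + 2) (b - 2) t s
      - (1 + (q + 1 - b) * t * β) * kerI β (q + 1) (b - 1) t s) (volume.restrict (Ioi 0)) :=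
    (i2.const_mul (t ^ 2 * (1 - b) * β ^ 2)).sub (i1.const_mul (1 + (q + 1 - b) * t * β))
  have j2 : Integrable (fun s => t ^ 2 * (1 - b) * β ^ 2 * kerI β (q + 2) (b - 2) t s
      - (1 + (q + 1 - b) * t * β) * kerI β (q + 1) (b - 1) t s + q * kerI β q b t s)
      (volume.restrict (Ioi 0)) := j1.add (i0.const_mul q)
  have key := integral_Ioi_of_hasDerivAt_of_tendsto (a := 0) (m := 0)
    (f := fun s => kerI β (q + 1) (b - 1) t s)
    (f' := fun s => t ^ 2 * (1 - b) * β ^ 2 * kerI β (q + 2) (b - 2) t s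
      - (1 + (q + 1 - b) * t * β) * kerI β (q + 1) (b - 1) t s + q * kerI β q b t s) ?_ ?_ j2 ?_
  · rw [integral_add j1 (i0.const_mul q), integral_sub (i2.const_mul _) (i1.const_mul _),
      integral_const_mul, integral_const_mul, integral_const_mul] at key
    have h0 : kerI β (q + 1) (b - 1) t 0 = 0 := by
      unfold kerI
      rw [Real.zero_rpow (by linarith)]; simp
    rw [h0, sub_zero] at key
    exact key
  · apply ContinuousAt.continuousWithinAt
    unfold kerI
    refine ContinuousAt.mul (ContinuousAt.mul (by fun_prop) ?_) ?_
    · exact Real.continuousAt_rpow_const _ _ (Or.inr (by linarith))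
    · exact ContinuousAt.rpow_const (by fun_prop) (Or.inl (by simp))
  · intro s hs
    have hs : 0 < s := hs
    have hu : 0 < 1 + β * t * s := by positivity
    unfold kerI
    have h1 : HasDerivAt (fun s : ℝ => 1 + β * t * s) (β * t) s := by
      simpa using ((hasDerivAt_id s).const_mul (β * t)).const_add 1
    have h2 := h1.rpow_const (p := b - 1) (Or.inl hu.ne')
    have h3 := (hasDerivAt_id s).rpow_const (p := q + 1 - 1) (Or.inl hs.ne')
    have h4 := ((hasDerivAt_id s).neg).exp
    have h5 := (h4.mul h3).mul h2
    refine (h5.congr_deriv ?_)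
    simp only [id, Pi.neg_apply, Pi.mul_apply]
    have e1 : s ^ (q + 1 - 1) = s ^ (q - 1) * s := by
      rw [← Real.rpow_add_one hs.ne']; congr 1; ring
    have e2 : s ^ (q + 2 - 1) = s ^ (q - 1) * s ^ 2 := by
      rw [← Real.rpow_add_natCast hs.ne']; congr 1; push_cast; ring
    have e3 : s ^ (q + 1 - 1 - 1) = s ^ (q - 1) := by congr 1; ring
    have e4 : (1 + β * t * s) ^ (b - 1) = (1 + β * t * s) ^ (b - 2) * (1 + β * t * s) := by
      rw [← Real.rpow_add_one hu.ne']; congr 1; ring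
    have e5 : (1 + β * t * s) ^ b = (1 + β * t * s) ^ (b - 2) * (1 + β * t * s) ^ 2 := by
      rw [← Real.rpow_add_natCast hu.ne']; congr 1; push_cast; ring
    have e6 : (1 + β * t * s) ^ (b - 1 - 1) = (1 + β * t * s) ^ (b - 2) := by congr 1; ring
    rw [e3, e1, e2, e6, e4, e5]
    ring
  · have hl := (tendsto_rpow_mul_exp_neg_mul_atTop_nhds_zero (q + 1 - 1) (1/2) (by norm_num)).const_mul
      ((1 + 2 * (|b - 1| + 1) * (β * t)) ^ (|b - 1| + 1))
    rw [mul_zero] at hl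
    refine squeeze_zero_norm' ?_ hl
    filter_upwards [eventually_gt_atTop 0] with s hs
    have := kerI_bound (a := q + 1) (b := b - 1) hβ ht le_rfl hs
    rwa [Real.rpow_one] at this

lemma const_of_deriv {f : ℝ → ℝ} (hc : ContinuousOn f (Ici 0)) (hd : ∀ t, 0 < t → HasDerivAt f 0 t) :
    ∀ t ∈ Ici (0:ℝ), f t = f 0 := by
  intro t ht
  have hdiff : DifferentiableOn ℝ f (interior (Ici 0)) := by
    rw [interior_Ici]; intro x hx
    exact (hd x hx).differentiableAt.differentiableWithinAt
  have h1 := monotoneOn_of_deriv_nonneg (convex_Ici 0) hc hdiff (by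
    rw [interior_Ici]; intro x hx; rw [(hd x hx).deriv]) self_mem_Ici ht ht
  have h2 := antitoneOn_of_deriv_nonpos (convex_Ici 0) hc hdiff (by
    rw [interior_Ici]; intro x hx; rw [(hd x hx).deriv]) self_mem_Ici ht ht
  exact le_antisymm h2 h1

lemma ode_unique (m : ℕ) (α c : ℝ) (hα : 0 < α) (A B : ℝ → ℝ)
    (hA : ContDiffOn ℝ (⊤ : ℕ∞) A (Ici 0)) (hB : ContDiffOn ℝ (⊤ : ℕ∞) B (Ici 0))
    (hA0 : A 0 = 1) (hB0 : B 0 = 1) (hpos : ∀ t ∈ Ici (0:ℝ), A t ≠ 0)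
    (oA : ∀ t ∈ Ici (0:ℝ), 4 * t ^ 2 * derivWithin (derivWithin A (Ici 0)) (Ici 0) t
            + 2 * (α + ((m : ℝ) + 6) * t) * derivWithin A (Ici 0) t + c * A t = 0)
    (oB : ∀ t ∈ Ici (0:ℝ), 4 * t ^ 2 * derivWithin (derivWithin B (Ici 0)) (Ici 0) t
            + 2 * (α + ((m : ℝ) + 6) * t) * derivWithin B (Ici 0) t + c * B t = 0) :
    ∀ t ∈ Ici (0:ℝ), B t = A t := by
  have hA1 : ContDiffOn ℝ 1 (derivWithin A (Ici 0)) (Ici 0) :=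
    hA.derivWithin (uniqueDiffOn_Ici 0) (by norm_cast)
  have hB1 : ContDiffOn ℝ 1 (derivWithin B (Ici 0)) (Ici 0) :=
    hB.derivWithin (uniqueDiffOn_Ici 0) (by norm_cast)
  have dd : ∀ f : ℝ → ℝ, DifferentiableOn ℝ f (Ici 0) → ∀ t, 0 < t →
      HasDerivAt f (derivWithin f (Ici 0) t) t := fun f hf t ht =>
    (hf t ht.le).hasDerivWithinAt.hasDerivAt (Ici_mem_nhds ht)
  have dA := dd A (hA.differentiableOn (by simp))
  have dB := dd B (hB.differentiableOn (by simp))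
  have dA1 := dd _ (hA1.differentiableOn (by simp))
  have dB1 := dd _ (hB1.differentiableOn (by simp))
  have cA := hA.continuousOn
  have cB := hB.continuousOn
  have cA1 := hA1.continuousOn
  have cB1 := hB1.continuousOn
  generalize derivWithin (derivWithin A (Ici 0)) (Ici 0) = A2 at *
  generalize derivWithin (derivWithin B (Ici 0)) (Ici 0) = B2 at *
  generalize derivWithin A (Ici 0) = A1 at *
  generalize derivWithin B (Ici 0) = B1 at *
  set W : ℝ → ℝ := fun t => A t * B1 t - A1 t * B t with hW
  have cW : ContinuousOn W (Ici 0) := (cA.mul cB1).sub (cA1.mul cB)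
  have dW : ∀ t, 0 < t → HasDerivAt W (A t * B2 t - A2 t * B t) t := by
    intro t ht
    exact (((dA t ht).mul (dB1 t ht)).sub ((dA1 t ht).mul (dB t ht))).congr_deriv (by ring)
  have hG := const_of_deriv (f := fun t => (W t) ^ 2 * t ^ (m + 6) * Real.exp (-α / t)) ?_ ?_
  · have W0 : ∀ t, 0 < t → W t = 0 := by
      intro t ht
      have := hG t ht.le
      simp only [ne_eq, Nat.add_eq_zero_iff, OfNat.ofNat_ne_zero, and_false, not_false_eq_true,
        zero_pow, mul_zero, zero_mul] at this
      have h1 : 0 < t ^ (m + 6) := by positivity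
      have h2 := Real.exp_pos (-α / t)
      have h3 : (W t) ^ 2 = 0 := by
        rcases mul_eq_zero.1 this with h | h
        · exact (mul_eq_zero.1 h).resolve_right h1.ne'
        · exact absurd h h2.ne'
      exact pow_eq_zero_iff (two_ne_zero) |>.1 h3
    have hQ := const_of_deriv (f := fun t => B t / A t) (cB.div cA hpos) (by
      intro t ht
      refine ((dB t ht).div (dA t ht) (hpos t ht.le)).congr_deriv ?_
      have := W0 t ht
      simp only [hW] at this
      rw [div_eq_zero_iff]; left; linarith)
    intro t ht
    have := hQ t ht
    simp only [hA0, hB0, div_one] at this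
    exact (div_eq_one_iff_eq (hpos t ht)).1 this
  · intro t ht
    rcases (show 0 ≤ t from ht).eq_or_lt with rfl | ht0
    · have hl : Tendsto (fun t => (W t) ^ 2 * t ^ (m + 6)) (𝓝[≥] 0) (𝓝 ((W 0) ^ 2 * 0 ^ (m + 6))) :=
        ((cW.pow 2).mul (by fun_prop : ContinuousOn (fun t : ℝ => t ^ (m + 6)) (Ici 0))) 0 ht
      unfold ContinuousWithinAt
      simp only [ne_eq, Nat.add_eq_zero_iff, OfNat.ofNat_ne_zero, and_false, not_false_eq_true,
        zero_pow, mul_zero, zero_mul] at hl ⊢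
      refine squeeze_zero_norm' ?_ hl
      filter_upwards [self_mem_nhdsWithin] with x hx
      have hx : 0 ≤ x := hx
      rw [Real.norm_of_nonneg (by positivity)]
      apply mul_le_of_le_one_right (by positivity)
      rw [Real.exp_le_one_iff]
      exact div_nonpos_of_nonpos_of_nonneg (by linarith) hx
    · refine ContinuousWithinAt.mul (ContinuousWithinAt.mul ((cW t ht).pow 2) (by fun_prop)) ?_
      apply ContinuousAt.continuousWithinAt
      have := ht0.ne'
      fun_prop (disch := assumption)
  · intro t ht
    have h1 := (dW t ht).pow 2
    have h2 := hasDerivAt_pow (m + 6) t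
    have h3 : HasDerivAt (fun t : ℝ => -α / t) (α / t ^ 2) t := by
      refine ((hasDerivAt_const t (-α)).div (hasDerivAt_id t) ht.ne').congr_deriv ?_
      simp
    refine ((h1.mul h2).mul h3.exp).congr_deriv ?_
    have e : 4 * t ^ 2 * (A t * B2 t - A2 t * B t) = - (2 * (α + ((m : ℝ) + 6) * t)) * W t := by
      simp only [hW]
      linear_combination (A t) * oB t ht.le - (B t) * oA t ht.le
    have e' : A t * B2 t - A2 t * B t = - (2 * (α + ((m : ℝ) + 6) * t)) * W t / (4 * t ^ 2) := by
      rw [eq_div_iff (by positivity)]; linarith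
    simp only [Pi.pow_apply, Pi.mul_apply]
    rw [e']
    have : t ^ (m + 6) = t ^ (m + 6 - 1) * t := by
      rw [← pow_succ]; congr 1
    rw [this]
    push_cast
    field_simp
    ring

end Aux


/-- For integers `m ≥ 3`, `k ≥ 0` and a real `α > 0`, with `K = k(m+k-2)`,
there is exactly one function `A : [0,∞) → ℝ`, infinitely differentiable on `[0,∞)` (with
one-sided derivatives at `0`), with `A(0) = 1`, solving
`4t²A''(t) + 2(α+(m+6)t)A'(t) + (3(m+1)-K)A(t) = 0` on `[0,∞)`.  Uniqueness means any two
such solutions agree on `[0,∞)`. -/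
theorem ode_expander_mode_existence_uniqueness
    (m k : ℕ) (hm : 3 ≤ m) (α : ℝ) (hα : 0 < α) :
    ∃ A : ℝ → ℝ,
      (ContDiffOn ℝ (⊤ : ℕ∞) A (Set.Ici 0) ∧ A 0 = 1 ∧
        ∀ t ∈ Set.Ici (0:ℝ),
          4 * t ^ 2 * derivWithin (derivWithin A (Set.Ici 0)) (Set.Ici 0) t
            + 2 * (α + ((m : ℝ) + 6) * t) * derivWithin A (Set.Ici 0) t
            + (3 * ((m : ℝ) + 1) - (k : ℝ) * ((m : ℝ) + (k : ℝ) - 2)) * A t = 0) ∧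
      ∀ B : ℝ → ℝ,
        (ContDiffOn ℝ (⊤ : ℕ∞) B (Set.Ici 0) ∧ B 0 = 1 ∧
          ∀ t ∈ Set.Ici (0:ℝ),
            4 * t ^ 2 * derivWithin (derivWithin B (Set.Ici 0)) (Set.Ici 0) t
              + 2 * (α + ((m : ℝ) + 6) * t) * derivWithin B (Set.Ici 0) t
              + (3 * ((m : ℝ) + 1) - (k : ℝ) * ((m : ℝ) + (k : ℝ) - 2)) * B t = 0) →
        ∀ t ∈ Set.Ici (0:ℝ), B t = A t := by
  set p : ℝ := (3 - (k:ℝ)) / 2 with hp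
  set q : ℝ := ((m:ℝ) + k + 1) / 2 with hq
  have hq0 : 0 < q := by positivity
  set β : ℝ := 2 / α with hβd
  have hβ : 0 < β := by positivity
  have hαβ : α * β = 2 := by rw [hβd]; field_simp
  have hGam : lapI β q (-p) 0 ≠ 0 := (lapI_pos hβ hq0 le_rfl).ne'
  set C : ℝ := (lapI β q (-p) 0)⁻¹ with hC
  set A : ℝ → ℝ := fun t => C * lapI β q (-p) t with hAd
  have d1 : ∀ t ∈ Set.Ici (0:ℝ), HasDerivWithinAt A
      (C * (-p * β * lapI β (q + 1) (-p - 1) t)) (Set.Ici 0) t := fun t ht =>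
    (lapI_deriv hβ hq0 ht).const_mul C
  have e1 : ∀ t ∈ Set.Ici (0:ℝ), derivWithin A (Set.Ici 0) t
      = C * (-p * β * lapI β (q + 1) (-p - 1) t) := fun t ht =>
    (d1 t ht).derivWithin (uniqueDiffOn_Ici 0 t ht)
  have e2 : ∀ t ∈ Set.Ici (0:ℝ), derivWithin (derivWithin A (Set.Ici 0)) (Set.Ici 0) t
      = C * (-p * β * ((-p - 1) * β * lapI β (q + 1 + 1) (-p - 1 - 1) t)) := by
    intro t ht
    rw [derivWithin_congr e1 (e1 t ht)]
    exact (((lapI_deriv hβ (by linarith) ht).const_mul (-p * β)).const_mul C).derivWithin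
      (uniqueDiffOn_Ici 0 t ht)
  have hA : ContDiffOn ℝ (⊤ : ℕ∞) A (Set.Ici 0) := by
    rw [contDiffOn_infty]
    exact fun n => contDiffOn_const.mul (lapI_contDiff_nat hβ n q (-p) hq0)
  have hA0 : A 0 = 1 := inv_mul_cancel₀ hGam
  have oA : ∀ t ∈ Set.Ici (0:ℝ),
          4 * t ^ 2 * derivWithin (derivWithin A (Set.Ici 0)) (Set.Ici 0) t
            + 2 * (α + ((m : ℝ) + 6) * t) * derivWithin A (Set.Ici 0) t
            + (3 * ((m : ℝ) + 1) - (k : ℝ) * ((m : ℝ) + (k : ℝ) - 2)) * A t = 0 := by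
    intro t ht
    rw [e2 t ht, e1 t ht]
    have h := lapI_ode (b := -p) hβ hq0 ht
    have a1 : q + 1 + 1 = q + 2 := by ring
    have a2 : -p - 1 - 1 = -p - 2 := by ring
    rw [a1, a2]
    simp only [hAd]
    have c1 : (3 * ((m : ℝ) + 1) - (k : ℝ) * ((m : ℝ) + (k : ℝ) - 2)) = 4 * p * q := by
      rw [hp, hq]; ring
    have c2 : (m : ℝ) + 6 = 2 * p + 2 * q + 2 := by rw [hp, hq]; ring
    rw [c1, c2]
    linear_combination (4 * p * C) * h - (2 * C * p * lapI β (q + 1) (-p - 1) t) * hαβ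
  refine ⟨A, ⟨hA, hA0, oA⟩, ?_⟩
  rintro B ⟨hB, hB0, oB⟩
  refine ode_unique m α _ hα A B hA hB hA0 hB0 ?_ oA oB
  intro t ht
  exact mul_ne_zero (inv_ne_zero hGam) (lapI_pos hβ hq0 ht).ne'
end

section
/- Let m ≥ 3 and k ≥ 0 be integers and α > 0 a real number, write K = k(m+k−2), and assume K > 3(m+1). Suppose A : [0,∞) → ℝ is infinitely differentiable on [0,∞) (one-sided derivatives at 0), satisfies A(0) = 1, and satisfies 4t²·A''(t) + 2(α + (m+6)t)·A'(t) + (3(m+1) − K)·A(t) = 0 for all t ∈ [0,∞). Then A'(t) > 0 for all t ∈ [0,∞); in particular A is strictly increasing on [0,∞) and A(t) ≥ 1 for all t ≥ 0. -/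
/-- For integers `m ≥ 3`, `k ≥ 0`, real `α > 0`, and `K = k(m+k-2)` with
`K > 3(m+1)`: if `A` is infinitely differentiable on `[0,∞)` (one-sided derivatives at `0`),
`A(0) = 1`, and `4t²A'' + 2(α+(m+6)t)A' + (3(m+1)-K)A = 0` on `[0,∞)`, then `A'(t) > 0`
for all `t ≥ 0`; in particular `A` is strictly increasing on `[0,∞)` and `A(t) ≥ 1`. -/
theorem ode_expander_mode_strictly_increasing
    (m k : ℕ) (hm : 3 ≤ m) (α : ℝ) (hα : 0 < α)
    (hK : 3 * ((m : ℝ) + 1) < (k : ℝ) * ((m : ℝ) + (k : ℝ) - 2))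
    (A : ℝ → ℝ)
    (hA : ContDiffOn ℝ (⊤ : ℕ∞) A (Set.Ici 0))
    (hA0 : A 0 = 1)
    (hODE : ∀ t ∈ Set.Ici (0:ℝ),
      4 * t ^ 2 * derivWithin (derivWithin A (Set.Ici 0)) (Set.Ici 0) t
        + 2 * (α + ((m : ℝ) + 6) * t) * derivWithin A (Set.Ici 0) t
        + (3 * ((m : ℝ) + 1) - (k : ℝ) * ((m : ℝ) + (k : ℝ) - 2)) * A t = 0) :
    (∀ t ∈ Set.Ici (0:ℝ), 0 < derivWithin A (Set.Ici 0) t) ∧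
    StrictMonoOn A (Set.Ici 0) ∧
    ∀ t ∈ Set.Ici (0:ℝ), 1 ≤ A t := by
  have hu : UniqueDiffOn ℝ (Set.Ici (0:ℝ)) := uniqueDiffOn_Ici 0
  have hB : ContDiffOn ℝ 1 (derivWithin A (Set.Ici 0)) (Set.Ici 0) :=
    hA.derivWithin hu (WithTop.coe_le_coe.2 (le_top : (2 : ℕ∞) ≤ ⊤))
  have hAd : DifferentiableOn ℝ A (Set.Ici 0) := hA.differentiableOn (by simp)
  have hAc : ContinuousOn A (Set.Ici 0) := hA.continuousOn
  have hBd : DifferentiableOn ℝ (derivWithin A (Set.Ici 0)) (Set.Ici 0) :=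
    hB.differentiableOn (by simp)
  have hBc : ContinuousOn (derivWithin A (Set.Ici 0)) (Set.Ici 0) := hB.continuousOn
  have hder : ∀ x : ℝ, 0 < x → deriv A x = derivWithin A (Set.Ici 0) x := fun x hx =>
    (derivWithin_of_mem_nhds (Ici_mem_nhds hx)).symm
  have h0 : 0 < derivWithin A (Set.Ici 0) 0 := by
    have h := hODE 0 (by simp)
    rw [hA0] at h
    by_contra hn
    push Not at hn
    nlinarith [mul_nonneg hα.le (neg_nonneg.2 hn)]
  have hpos : ∀ t ∈ Set.Ici (0:ℝ), 0 < derivWithin A (Set.Ici 0) t := by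
    intro s hs
    by_contra hn
    push Not at hn
    set S : Set ℝ := Set.Ici 0 ∩ (derivWithin A (Set.Ici 0)) ⁻¹' Set.Iic 0 with hS
    have hSc : IsClosed S := hBc.preimage_isClosed_of_isClosed isClosed_Ici isClosed_Iic
    have hSb : BddBelow S := ⟨0, fun x hx => hx.1⟩
    have hmem : sInf S ∈ S := hSc.csInf_mem ⟨s, hs, hn⟩ hSb
    set T := sInf S with hT
    obtain ⟨hT0, hTB⟩ := hmem
    simp only [Set.mem_preimage, Set.mem_Iic, Set.mem_Ici] at hT0 hTB
    have hTpos : 0 < T := by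
      rcases hT0.lt_or_eq with h | h
      · exact h
      · rw [← h] at hTB
        linarith
    have hlt : ∀ x, 0 ≤ x → x < T → 0 < derivWithin A (Set.Ici 0) x := by
      intro x hx hxT
      by_contra hc
      push Not at hc
      exact absurd (csInf_le hSb (show x ∈ S from ⟨hx, hc⟩)) (not_le.2 hxT)
    have hmono : StrictMonoOn A (Set.Icc 0 T) := by
      apply strictMonoOn_of_deriv_pos (convex_Icc 0 T) (hAc.mono Set.Icc_subset_Ici_self)
      intro x hx
      rw [interior_Icc] at hx
      rw [hder x hx.1]
      exact hlt x hx.1.le hx.2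
    have hAT : 1 < A T := hA0 ▸ hmono ⟨le_rfl, hT0⟩ ⟨hT0, le_rfl⟩ hTpos
    have hode := hODE T hT0
    have hd2 : 0 < derivWithin (derivWithin A (Set.Ici 0)) (Set.Ici 0) T := by
      by_contra hc
      push Not at hc
      have h1 : 0 ≤ T ^ 2 * -derivWithin (derivWithin A (Set.Ici 0)) (Set.Ici 0) T :=
        mul_nonneg (by positivity) (by linarith)
      have h2 : 0 ≤ (α + ((m : ℝ) + 6) * T) * -derivWithin A (Set.Ici 0) T :=
        mul_nonneg (by positivity) (by linarith)
      have h3 : 0 < ((k : ℝ) * ((m : ℝ) + (k : ℝ) - 2) - 3 * ((m : ℝ) + 1)) * A T :=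
        mul_pos (by linarith) (by linarith)
      nlinarith
    have hHD : HasDerivAt (derivWithin A (Set.Ici 0))
        (derivWithin (derivWithin A (Set.Ici 0)) (Set.Ici 0) T) T :=
      (hBd T hT0).hasDerivWithinAt.hasDerivAt (Ici_mem_nhds hTpos)
    have hsl := (hasDerivAt_iff_tendsto_slope.1 hHD).eventually (lt_mem_nhds hd2)
    have hsl2 : ∀ᶠ x in nhdsWithin T (Set.Iio T),
        0 < slope (derivWithin A (Set.Ici 0)) T x :=
      hsl.filter_mono (nhdsWithin_mono T (fun x hx => ne_of_lt hx))
    have hev : ∀ᶠ x in nhdsWithin T (Set.Iio T), x ∈ Set.Ioo 0 T := Ioo_mem_nhdsLT hTpos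
    obtain ⟨x, hx1, hx2⟩ := (hsl2.and hev).exists
    have hBx := hlt x hx2.1.le hx2.2
    rw [slope_def_field] at hx1
    have := div_neg_of_pos_of_neg
      (show 0 < derivWithin A (Set.Ici 0) x - derivWithin A (Set.Ici 0) T by linarith)
      (show x - T < 0 by linarith [hx2.2])
    linarith
  have hsm : StrictMonoOn A (Set.Ici 0) := by
    apply strictMonoOn_of_deriv_pos (convex_Ici 0) hAc
    intro x hx
    rw [interior_Ici] at hx
    rw [hder x hx]
    exact hpos x (Set.mem_Ici.2 (le_of_lt (Set.mem_Ioi.1 hx)))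
  refine ⟨hpos, hsm, fun t ht => ?_⟩
  rw [← hA0]
  exact hsm.monotoneOn (Set.mem_Ici.2 le_rfl) ht ht
end

section
/- Let m ≥ 3 and k ≥ 0 be integers and α > 0 a real number, write K = k(m+k−2), and assume K > 3(m+1). Suppose A : [0,∞) → ℝ is infinitely differentiable on [0,∞) (one-sided derivatives at 0), satisfies A(0) = 1, and satisfies 4t²·A''(t) + 2(α + (m+6)t)·A'(t) + (3(m+1) − K)·A(t) = 0 for all t ∈ [0,∞). Then for all t ∈ [0,∞) one has 0 ≤ A'(t) and 2α·A'(t) ≤ (K − 3(m+1))·A(t); equivalently, 0 ≤ A'(t)/A(t) ≤ (K − 3(m+1))/(2α). -/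
lemma left_lt_of_deriv_pos (f : ℝ → ℝ) (d s : ℝ) (hs : 0 < s) (h : HasDerivAt f d s)
    (hd : 0 < d) : ∃ x, 0 < x ∧ x < s ∧ f x < f s := by
  have h1 := (hasDerivAt_iff_tendsto_slope.1 h).eventually (lt_mem_nhds hd)
  have h2 : ∀ᶠ x in nhdsWithin s (Set.Iio s), 0 < slope f s x :=
    h1.filter_mono (nhdsWithin_mono _ (fun x hx => ne_of_lt hx))
  have h3 : ∀ᶠ x in nhdsWithin s (Set.Iio s), x ∈ Set.Ioo 0 s := Ioo_mem_nhdsLT hs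
  obtain ⟨x, hx, hx0, hxs⟩ := (h2.and h3).exists
  refine ⟨x, hx0, hxs, ?_⟩
  rw [slope_def_field] at hx
  by_contra hcon
  have : (f x - f s) / (x - s) ≤ 0 :=
    div_nonpos_of_nonneg_of_nonpos (by linarith) (by linarith)
  linarith

lemma ode_aux (c α n : ℝ) (hc : 0 < c) (hα : 0 < α) (hn : 0 < n) (A B B' : ℝ → ℝ)
    (hAc : ContinuousOn A (Set.Ici 0)) (hBc : ContinuousOn B (Set.Ici 0))
    (hAB : ∀ t, 0 < t → HasDerivAt A (B t) t) (hBB : ∀ t, 0 < t → HasDerivAt B (B' t) t)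
    (hA0 : A 0 = 1)
    (hODE : ∀ t, 0 ≤ t → 4 * t ^ 2 * B' t + 2 * (α + n * t) * B t - c * A t = 0) :
    ∀ t, 0 ≤ t → 0 ≤ B t ∧ 2 * α * B t ≤ c * A t := by
  have hB0 : 0 < B 0 := by
    have := hODE 0 le_rfl
    rw [hA0] at this
    by_contra hcon
    nlinarith
  have hB : ∀ t, 0 ≤ t → 0 < B t := by
    intro t ht
    by_contra hcon
    have hcomp : IsCompact (Set.Icc 0 t ∩ B ⁻¹' Set.Iic 0) :=
      isCompact_Icc.of_isClosed_subset
        ((hBc.mono Set.Icc_subset_Ici_self).preimage_isClosed_of_isClosed isClosed_Icc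
          isClosed_Iic) Set.inter_subset_left
    obtain ⟨s, ⟨⟨hs0, hst⟩, hsB⟩, hmin⟩ := hcomp.exists_isLeast
      ⟨t, ⟨ht, le_rfl⟩, not_lt.1 hcon⟩
    have hsB : B s ≤ 0 := hsB
    have hs : 0 < s := by
      rcases hs0.eq_or_lt with h | h
      · rw [← h] at hsB; linarith
      · exact h
    have hlt : ∀ x, 0 ≤ x → x < s → 0 < B x := by
      intro x hx hxs
      by_contra h
      have := hmin ⟨⟨hx, by linarith⟩, not_lt.1 h⟩
      linarith
    have hmono : MonotoneOn A (Set.Icc 0 s) := by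
      apply monotoneOn_of_deriv_nonneg (convex_Icc 0 s) (hAc.mono Set.Icc_subset_Ici_self)
      · intro x hx
        rw [interior_Icc] at hx
        exact (hAB x hx.1).differentiableAt.differentiableWithinAt
      · intro x hx
        rw [interior_Icc] at hx
        rw [(hAB x hx.1).deriv]
        exact (hlt x hx.1.le hx.2).le
    have hAs : 1 ≤ A s := hA0 ▸ hmono ⟨le_rfl, hs0⟩ ⟨hs0, le_rfl⟩ hs0
    have hB' : 0 < B' s := by
      have h1 := hODE s hs0
      have h2 : 0 < c * A s := by positivity
      have h3 : 2 * (α + n * s) * B s ≤ 0 :=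
        mul_nonpos_of_nonneg_of_nonpos (by positivity) hsB
      have h4 : 0 < 4 * s ^ 2 * B' s := by linarith
      exact (pos_iff_pos_of_mul_pos h4).1 (by positivity)
    obtain ⟨x, hx0, hxs, hx⟩ := left_lt_of_deriv_pos B _ s hs (hBB s hs) hB'
    have := hlt x hx0.le hxs
    linarith
  intro t ht
  refine ⟨(hB t ht).le, ?_⟩
  by_contra hcon
  obtain ⟨s, ⟨hs0, hst⟩, hmin⟩ := isCompact_Icc.exists_isMinOn (Set.nonempty_Icc.2 ht)
    (((hAc.const_mul c).sub (hBc.const_mul (2 * α))).mono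
      (Set.Icc_subset_Ici_self : Set.Icc 0 t ⊆ Set.Ici 0))
  have hmin' : ∀ x, 0 ≤ x → x ≤ t → c * A s - 2 * α * B s ≤ c * A x - 2 * α * B x :=
    fun x h1 h2 => hmin ⟨h1, h2⟩
  have hneg := hmin' t ht le_rfl
  have hs : 0 < s := by
    rcases hs0.eq_or_lt with h | h
    · have := hODE 0 le_rfl
      rw [← h] at hneg
      linarith
    · exact h
  have hBs := hB s hs0
  have hB' : B' s < 0 := by
    have h1 := hODE s hs0
    have h3 : 0 < 2 * (n * s) * B s := by positivity
    have h4 : 4 * s ^ 2 * B' s < 0 := by linarith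
    by_contra h
    have : 0 ≤ 4 * s ^ 2 * B' s := mul_nonneg (by positivity) (not_lt.1 h)
    linarith
  obtain ⟨x, hx0, hxs, hx⟩ := left_lt_of_deriv_pos (fun y => c * A y - 2 * α * B y) _ s hs
    (((hAB s hs).const_mul c).sub ((hBB s hs).const_mul (2 * α))) (by
      have h1 : 0 < c * B s := by positivity
      have h2 : 2 * α * B' s < 0 := mul_neg_of_pos_of_neg (by positivity) hB'
      linarith)
  have := hmin' x hx0.le (by linarith)
  linarith

/-- For integers `m ≥ 3`, `k ≥ 0`, real `α > 0`, and `K = k(m+k-2)` with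
`K > 3(m+1)`: if `A` is infinitely differentiable on `[0,∞)` (one-sided derivatives at `0`),
`A(0) = 1`, and `4t²A'' + 2(α+(m+6)t)A' + (3(m+1)-K)A = 0` on `[0,∞)`, then for all `t ≥ 0`
one has `0 ≤ A'(t)` and `2αA'(t) ≤ (K - 3(m+1))·A(t)`. -/
theorem ode_expander_mode_log_derivative_bound
    (m k : ℕ) (hm : 3 ≤ m) (α : ℝ) (hα : 0 < α)
    (hK : 3 * ((m : ℝ) + 1) < (k : ℝ) * ((m : ℝ) + (k : ℝ) - 2))
    (A : ℝ → ℝ)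
    (hA : ContDiffOn ℝ (⊤ : ℕ∞) A (Set.Ici 0))
    (hA0 : A 0 = 1)
    (hODE : ∀ t ∈ Set.Ici (0:ℝ),
      4 * t ^ 2 * derivWithin (derivWithin A (Set.Ici 0)) (Set.Ici 0) t
        + 2 * (α + ((m : ℝ) + 6) * t) * derivWithin A (Set.Ici 0) t
        + (3 * ((m : ℝ) + 1) - (k : ℝ) * ((m : ℝ) + (k : ℝ) - 2)) * A t = 0) :
    ∀ t ∈ Set.Ici (0:ℝ),
      0 ≤ derivWithin A (Set.Ici 0) t ∧
      2 * α * derivWithin A (Set.Ici 0) t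
        ≤ ((k : ℝ) * ((m : ℝ) + (k : ℝ) - 2) - 3 * ((m : ℝ) + 1)) * A t := by
  have hAd : ContDiffOn ℝ 1 (derivWithin A (Set.Ici 0)) (Set.Ici 0) :=
    hA.derivWithin (uniqueDiffOn_Ici 0) (by norm_cast)
  have hder : ∀ f : ℝ → ℝ, DifferentiableOn ℝ f (Set.Ici 0) → ∀ t, 0 < t →
      HasDerivAt f (derivWithin f (Set.Ici 0) t) t := fun f hf t ht =>
    (hf t ht.le).hasDerivWithinAt.hasDerivAt (Ici_mem_nhds ht)
  intro t ht
  exact ode_aux _ α ((m : ℝ) + 6) (sub_pos.2 hK) hα (by positivity) A _ _ hA.continuousOn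
    hAd.continuousOn (hder _ (hA.differentiableOn (by simp)))
    (hder _ (hAd.differentiableOn (by simp))) hA0
    (fun t ht => by have := hODE t ht; linarith) t ht
end

section
/- Let U be an open neighbourhood of 0 in ℝ^m, let f : U → ℝ be real analytic, and let k ≥ 0 be an integer. Then there exist an open neighbourhood V of 0 with V ⊆ U and a constant C ≥ 0 such that for all x = (x_1,…,x_m) ∈ V: | f(0) − Σ_{j=0}^{k} Σ_{i_1,…,i_j = 1}^{m} ((−1)^j / j!) · x_{i_1}⋯x_{i_j} · (∂^j f / ∂x_{i_1}⋯∂x_{i_j})(x) | ≤ C · (x_1² + ⋯ + x_m²)^{(k+1)/2} · ( Σ_{i_1,…,i_{k+1} = 1}^{m} ((∂^{k+1} f / ∂x_{i_1}⋯∂x_{i_{k+1}})(x))² )^{1/2}. -/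
namespace ReversedTaylor

section
open Filter Topology

section Hadamard
variable {F : Type*} [NormedAddCommGroup F] [NormedSpace ℝ F]

theorem hadamard (ℓ : F →L[ℝ] ℝ) (e : F) {f : F → ℝ} (hf : AnalyticAt ℝ f 0) :
    ∃ g : F → ℝ, AnalyticAt ℝ g 0 ∧ ∀ᶠ z in 𝓝 (0:F), f z = f (z - ℓ z • e) + ℓ z * g z := by
  classical
  obtain ⟨p, r, hp⟩ := hf
  let P : F →L[ℝ] F := ContinuousLinearMap.id ℝ F - ℓ.smulRight e
  have hP : ∀ z, P z = z - ℓ z • e := fun z => by simp [P]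
  let M : (n : ℕ) → Fin (n+1) → Fin n → (F →L[ℝ] F) := fun n k i =>
    if k.succAbove i < k then ContinuousLinearMap.id ℝ F else P
  let q : FormalMultilinearSeries ℝ F ℝ := fun n =>
    ∑ k : Fin (n+1), ((p (n+1)).curryMid k e).compContinuousLinearMap (M n k)
  have hkey : ∀ n z, p (n+1) (fun _ => z) - p (n+1) (fun _ => P z) = ℓ z * q n (fun _ => z) := by
    intro n z
    have h := (p (n+1)).toMultilinearMap.map_sub_map_piecewise (fun _ => z) (fun _ => P z) Finset.univ
    simp only [Finset.piecewise_univ, ContinuousMultilinearMap.coe_coe] at h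
    rw [h]
    simp only [q, sum_apply, Finset.mul_sum]
    refine Finset.sum_congr rfl fun k _ => ?_
    rw [ContinuousMultilinearMap.compContinuousLinearMap_apply,
      ContinuousMultilinearMap.curryMid_apply]
    have h2 := (p (n+1)).toMultilinearMap.map_update_smul (k.insertNth e fun i => M n k i z) k (ℓ z) e
    simp only [Fin.update_insertNth, ContinuousMultilinearMap.coe_coe, smul_eq_mul] at h2
    rw [← h2]
    congr 1
    funext j
    refine Fin.succAboveCases k ?_ (fun i => ?_) j
    · simp [hP]
    · simp only [Finset.mem_univ, forall_true_left, Fin.insertNth_apply_succAbove, M]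
      by_cases h3 : k.succAbove i < k
      · simp [h3]
      · simp [h3, (Fin.succAbove_ne k i).symm]
  have hrad : 0 < q.radius := by
    obtain ⟨C, a, hC, ha, hb⟩ := p.le_mul_pow_of_radius_pos hp.radius_pos
    let K : ℝ := max 1 ‖P‖
    have hK1 : 1 ≤ K := le_max_left _ _
    let s : ℝ := 1 / (2 * a * K)
    have hs : 0 < s := by positivity
    have hq : ∀ n, ‖q n‖ ≤ (n+1) * (C * a^(n+1) * ‖e‖ * K^n) := by
      intro n
      refine (norm_sum_le _ _).trans ?_
      refine (Finset.sum_le_card_nsmul _ _ (C * a^(n+1) * ‖e‖ * K^n) fun k _ => ?_).trans ?_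
      · refine (ContinuousMultilinearMap.norm_compContinuousLinearMap_le _ _).trans ?_
        have h1 : ‖((p (n+1)).curryMid k) e‖ ≤ C * a^(n+1) * ‖e‖ := by
          refine (ContinuousLinearMap.le_opNorm _ _).trans ?_
          rw [ContinuousMultilinearMap.norm_curryMid]
          gcongr
          exact hb _
        have h2 : ∏ i, ‖M n k i‖ ≤ K^n := by
          refine (Finset.prod_le_prod (fun i _ => norm_nonneg _) (g := fun _ => K) fun i _ => ?_).trans (by simp)
          simp only [M]
          split_ifs
          · exact ContinuousLinearMap.norm_id_le.trans hK1
          · exact le_max_right _ _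
        gcongr
      · simp
    refine lt_of_lt_of_le ?_ (q.le_radius_of_bound (r := ⟨s, hs.le⟩) (C * a * ‖e‖) ?_)
    · exact ENNReal.coe_pos.2 (show (0:NNReal) < ⟨s, hs.le⟩ from hs)
    · intro n
      show ‖q n‖ * s^n ≤ _
      have h2n : ((n:ℝ)+1) ≤ 2^n := by exact_mod_cast Nat.lt_two_pow_self
      calc ‖q n‖ * s^n ≤ (n+1) * (C * a^(n+1) * ‖e‖ * K^n) * s^n := by gcongr; exact hq n
        _ = (n+1) / 2^n * (C * a * ‖e‖) := by
          have : s * (2 * a * K) = 1 := by simp only [s]; field_simp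
          have h4 : s^n * (2^n * a^n * K^n) = 1 := by rw [← mul_pow, ← mul_pow, ← mul_pow, this, one_pow]
          rw [div_mul_eq_mul_div, eq_div_iff (by positivity), pow_succ]
          linear_combination ((n:ℝ)+1) * (C * a * ‖e‖) * h4
        _ ≤ 1 * (C * a * ‖e‖) := by
          gcongr
          rw [div_le_one (by positivity)]; exact h2n
        _ = _ := one_mul _
  refine ⟨q.sum, (q.hasFPowerSeriesOnBall hrad).analyticAt, ?_⟩
  have e1 : ∀ᶠ z in 𝓝 (0:F), z ∈ Metric.eball (0:F) r := Metric.eball_mem_nhds _ hp.r_pos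
  have e2 : ∀ᶠ z in 𝓝 (0:F), P z ∈ Metric.eball (0:F) r :=
    P.continuous.continuousAt.eventually (by rw [map_zero]; exact Metric.eball_mem_nhds (0:F) hp.r_pos)
  have e3 : ∀ᶠ z in 𝓝 (0:F), z ∈ Metric.eball (0:F) q.radius := Metric.eball_mem_nhds _ hrad
  filter_upwards [e1, e2, e3] with z h1 h2 h3
  have s1 := hp.hasSum h1
  have s2 := hp.hasSum h2
  have s3 := (q.hasFPowerSeriesOnBall hrad).hasSum h3
  simp only [zero_add] at s1 s2 s3
  have s4 := (hasSum_nat_add_iff' 1).2 (s1.sub s2)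
  simp only [hkey] at s4
  have s5 := s4.unique (s3.mul_left (ℓ z))
  have h0 : p 0 (fun _ => z) = p 0 (fun _ => P z) := by congr 1; funext i; exact i.elim0
  simp [h0] at s5
  rw [← s5, hP]; ring
end Hadamard
end

section
open Filter Topology

section Germs
variable {F : Type*} [NormedAddCommGroup F] [NormedSpace ℝ F]

theorem germ_domain {f g : F → ℝ} (hf : AnalyticAt ℝ f 0) (hg : AnalyticAt ℝ g 0)
    (h : ∀ᶠ z in 𝓝 (0:F), f z * g z = 0) :
    (∀ᶠ z in 𝓝 (0:F), f z = 0) ∨ (∀ᶠ z in 𝓝 (0:F), g z = 0) := by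
  obtain ⟨r, hr, hB⟩ := Metric.eventually_nhds_iff_ball.1
    (hf.eventually_analyticAt.and (hg.eventually_analyticAt.and h))
  by_contra! hcon
  obtain ⟨h1, h2⟩ := hcon
  obtain ⟨z, hz, hzB⟩ := (h1.and_eventually (Metric.ball_mem_nhds (0:F) hr)).exists
  apply h2
  have hfz : ∀ᶠ y in 𝓝 z, f y ≠ 0 := (hB z hzB).1.continuousAt.eventually_ne hz
  have hgz : g =ᶠ[𝓝 z] 0 := by
    filter_upwards [hfz, Metric.isOpen_ball.mem_nhds hzB] with y hy hyB
    exact (mul_eq_zero.1 (hB y hyB).2.2).resolve_left hy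
  have hg' : AnalyticOnNhd ℝ g (Metric.ball 0 r) := fun y hy => (hB y hy).2.1
  have := hg'.eqOn_zero_of_preconnected_of_eventuallyEq_zero
    (convex_ball (0:F) r).isPreconnected hzB hgz
  filter_upwards [Metric.ball_mem_nhds (0:F) hr] with y hy
  exact not_not.2 (this hy)

theorem germ_mul_ne {f g : F → ℝ} (hf : AnalyticAt ℝ f 0) (hg : AnalyticAt ℝ g 0)
    (h1 : ¬ ∀ᶠ z in 𝓝 (0:F), f z = 0) (h2 : ¬ ∀ᶠ z in 𝓝 (0:F), g z = 0) :
    ¬ ∀ᶠ z in 𝓝 (0:F), f z * g z = 0 := fun h => (germ_domain hf hg h).elim h1 h2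

theorem germ_ne_of_ne {f : F → ℝ} (h0 : f 0 ≠ 0) : ¬ ∀ᶠ z in 𝓝 (0:F), f z = 0 :=
  fun h => h0 h.self_of_nhds

theorem germ_prod_ne {ι : Type*} (s : Finset ι) (f : ι → F → ℝ)
    (hf : ∀ i ∈ s, AnalyticAt ℝ (f i) 0) (h : ∀ i ∈ s, ¬ ∀ᶠ z in 𝓝 (0:F), f i z = 0) :
    ¬ ∀ᶠ z in 𝓝 (0:F), ∏ i ∈ s, f i z = 0 := by
  classical
  induction s using Finset.induction_on with
  | empty => simpa using NeBot.ne inferInstance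
  | insert a s ha ih =>
    simp only [Finset.prod_insert ha]
    refine germ_mul_ne (hf a (by simp)) ?_ (h a (by simp))
      (ih (fun i hi => hf i (by simp [hi])) (fun i hi => h i (by simp [hi])))
    exact Finset.analyticAt_fun_prod s fun i hi => hf i (by simp [hi])

end Germs

def mono {k : ℕ} (α : Fin k → ℕ) (z : Fin k → ℝ) : ℝ := ∏ i, z i ^ α i

theorem mono_add {k : ℕ} (α β : Fin k → ℕ) (z : Fin k → ℝ) :
    mono (α + β) z = mono α z * mono β z := by
  simp [mono, pow_add, Finset.prod_mul_distrib]

theorem mono_smul {k : ℕ} (n : ℕ) (α : Fin k → ℕ) (z : Fin k → ℝ) :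
    mono (n • α) z = mono α z ^ n := by
  simp [mono, Finset.prod_pow, pow_mul']

theorem mono_zero {k : ℕ} (z : Fin k → ℝ) : mono 0 z = 1 := by simp [mono]

theorem mono_single {k : ℕ} (i : Fin k) (n : ℕ) (z : Fin k → ℝ) :
    mono (Pi.single i n) z = z i ^ n := by
  rw [mono, Finset.prod_eq_single i]
  · simp
  · intro j _ hj; simp [hj]
  · simp

theorem analyticAt_coord {k : ℕ} (i : Fin k) (x : Fin k → ℝ) :
    AnalyticAt ℝ (fun z : Fin k → ℝ => z i) x :=
  (ContinuousLinearMap.proj (R := ℝ) (φ := fun _ : Fin k => ℝ) i).analyticAt x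

theorem mono_analytic {k : ℕ} (α : Fin k → ℕ) (x : Fin k → ℝ) : AnalyticAt ℝ (mono α) x :=
  Finset.analyticAt_fun_prod _ fun i _ => (analyticAt_coord i x).pow _

theorem mono_pos {k : ℕ} (α : Fin k → ℕ) {z : Fin k → ℝ} (hz : ∀ i, 0 < z i) : 0 < mono α z :=
  Finset.prod_pos fun i _ => pow_pos (hz i) _

theorem mono_at_zero {k : ℕ} {α : Fin k → ℕ} (h : α ≠ 0) : mono α (0 : Fin k → ℝ) = 0 := by
  obtain ⟨i, hi⟩ := Function.ne_iff.1 h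
  exact Finset.prod_eq_zero (Finset.mem_univ i) (by simpa using hi)

theorem coord_ne {k : ℕ} (i : Fin k) : ¬ ∀ᶠ z in 𝓝 (0 : Fin k → ℝ), z i = 0 := by
  intro h
  have hc : Tendsto (fun t : ℝ => (fun _ : Fin k => t)) (𝓝 0) (𝓝 (0 : Fin k → ℝ)) := by
    have : Continuous (fun t : ℝ => (fun _ : Fin k => t)) := by fun_prop
    exact this.tendsto' _ _ rfl
  have h2 : ∀ᶠ t in 𝓝 (0:ℝ), t = 0 := hc.eventually h
  have h3 : ∀ᶠ t in 𝓝[≠] (0:ℝ), t = 0 := h2.filter_mono nhdsWithin_le_nhds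
  have h4 : ∀ᶠ t in 𝓝[≠] (0:ℝ), t ≠ 0 := eventually_mem_nhdsWithin
  obtain ⟨t, h5, h6⟩ := (h3.and h4).exists
  exact h6 h5

/-- normal crossings with a given exponent -/
def NCw {k : ℕ} (α : Fin k → ℕ) (f : (Fin k → ℝ) → ℝ) : Prop :=
  ∃ u : (Fin k → ℝ) → ℝ, AnalyticAt ℝ u 0 ∧ u 0 ≠ 0 ∧
    ∀ᶠ z in 𝓝 (0 : Fin k → ℝ), f z = mono α z * u z

def NC {k : ℕ} (f : (Fin k → ℝ) → ℝ) : Prop := ∃ α, NCw α f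

theorem NCw.mul {k : ℕ} {α β : Fin k → ℕ} {f g : (Fin k → ℝ) → ℝ} (hf : NCw α f) (hg : NCw β g) :
    NCw (α + β) (fun z => f z * g z) := by
  obtain ⟨u, hu, hu0, h1⟩ := hf
  obtain ⟨v, hv, hv0, h2⟩ := hg
  refine ⟨fun z => u z * v z, hu.mul hv, mul_ne_zero hu0 hv0, ?_⟩
  filter_upwards [h1, h2] with z h1 h2
  rw [h1, h2, mono_add]; ring

theorem NCw.pow {k : ℕ} {α : Fin k → ℕ} {f : (Fin k → ℝ) → ℝ} (hf : NCw α f) (n : ℕ) :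
    NCw (n • α) (fun z => f z ^ n) := by
  obtain ⟨u, hu, hu0, h1⟩ := hf
  refine ⟨fun z => u z ^ n, hu.pow n, pow_ne_zero n hu0, ?_⟩
  filter_upwards [h1] with z h1
  rw [h1, mono_smul]; ring

theorem NCw.congr {k : ℕ} {α : Fin k → ℕ} {f g : (Fin k → ℝ) → ℝ} (hf : NCw α f)
    (h : ∀ᶠ z in 𝓝 (0 : Fin k → ℝ), g z = f z) : NCw α g := by
  obtain ⟨u, hu, hu0, h1⟩ := hf
  refine ⟨u, hu, hu0, ?_⟩
  filter_upwards [h1, h] with z h1 h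
  rw [h, h1]

theorem NC.mul {k : ℕ} {f g : (Fin k → ℝ) → ℝ} (hf : NC f) (hg : NC g) :
    NC (fun z => f z * g z) := by
  obtain ⟨α, hf⟩ := hf
  obtain ⟨β, hg⟩ := hg
  exact ⟨_, hf.mul hg⟩

theorem NC.pow {k : ℕ} {f : (Fin k → ℝ) → ℝ} (hf : NC f) (n : ℕ) : NC (fun z => f z ^ n) := by
  obtain ⟨α, hf⟩ := hf
  exact ⟨_, hf.pow n⟩

theorem NC.congr {k : ℕ} {f g : (Fin k → ℝ) → ℝ} (hf : NC f)
    (h : ∀ᶠ z in 𝓝 (0 : Fin k → ℝ), g z = f z) : NC g := by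
  obtain ⟨α, hf⟩ := hf
  exact ⟨_, hf.congr h⟩

theorem NC.unit {k : ℕ} {f : (Fin k → ℝ) → ℝ} (hf : AnalyticAt ℝ f 0) (h0 : f 0 ≠ 0) : NC f :=
  ⟨0, f, hf, h0, by simp [mono_zero]⟩

theorem NC.coord {k : ℕ} (i : Fin k) : NC (fun z : Fin k → ℝ => z i) :=
  ⟨Pi.single i 1, fun _ => 1, analyticAt_const, one_ne_zero, by simp [mono_single]⟩

theorem NC.prod {k : ℕ} {ι : Type*} (s : Finset ι) (f : ι → (Fin k → ℝ) → ℝ)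
    (h : ∀ i ∈ s, NC (f i)) : NC (fun z => ∏ i ∈ s, f i z) := by
  classical
  induction s using Finset.induction_on with
  | empty => simpa using NC.unit (k := k) analyticAt_const one_ne_zero
  | insert a s ha ih =>
    simp only [Finset.prod_insert ha]
    exact (h a (by simp)).mul (ih fun i hi => h i (by simp [hi]))

theorem mono_ne {k : ℕ} (α : Fin k → ℕ) : ¬ ∀ᶠ z in 𝓝 (0 : Fin k → ℝ), mono α z = 0 := by
  refine germ_prod_ne Finset.univ (fun i (z : Fin k → ℝ) => z i ^ α i) (fun i _ => (analyticAt_coord i 0).pow _)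
    fun i _ h => coord_ne i ?_
  filter_upwards [h] with z hz
  by_contra hx
  exact pow_ne_zero _ hx hz

theorem NC.ne {k : ℕ} {f : (Fin k → ℝ) → ℝ} (hf : NC f) :
    ¬ ∀ᶠ z in 𝓝 (0 : Fin k → ℝ), f z = 0 := by
  obtain ⟨α, u, hu, hu0, h⟩ := hf
  intro h2
  refine germ_mul_ne (mono_analytic α 0) hu (mono_ne α) (germ_ne_of_ne hu0) ?_
  filter_upwards [h, h2] with z h h2
  rw [← h, h2]

theorem NC.factor_aux {k : ℕ} (s : ℕ) : ∀ (γ : Fin k → ℕ) (f g w : (Fin k → ℝ) → ℝ), ∑ i, γ i = s →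
    AnalyticAt ℝ f 0 → AnalyticAt ℝ g 0 → AnalyticAt ℝ w 0 → w 0 ≠ 0 →
    (∀ᶠ z in 𝓝 (0 : Fin k → ℝ), f z * g z = mono γ z * w z) → NC f ∧ NC g := by
  induction s with
  | zero =>
    intro γ f g w hs hf hg hw hw0 h
    have hγ : γ = 0 := by
      funext i; exact (Finset.sum_eq_zero_iff.1 hs) i (Finset.mem_univ i)
    have h0 := h.self_of_nhds
    simp only [hγ, mono_zero, one_mul] at h0
    have : f 0 * g 0 ≠ 0 := h0 ▸ hw0
    exact ⟨NC.unit hf (left_ne_zero_of_mul this), NC.unit hg (right_ne_zero_of_mul this)⟩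
  | succ s ih =>
    intro γ f g w hs hf hg hw hw0 h
    have hex : ∃ i, γ i ≠ 0 := by
      by_contra! hc
      simp [hc] at hs
    obtain ⟨i, hi⟩ := hex
    obtain ⟨γ', hγ'⟩ : ∃ γ' : Fin k → ℕ, γ = γ' + Pi.single i 1 := by
      refine ⟨fun j => γ j - (Pi.single i 1 : Fin k → ℕ) j, ?_⟩
      funext j
      by_cases hj : j = i
      · subst hj; simp; omega
      · simp [hj]
    have hs' : ∑ i, γ' i = s := by
      rw [hγ'] at hs
      simp [Finset.sum_add_distrib] at hs
      exact hs
    -- symmetric step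
    have step : ∀ f g : (Fin k → ℝ) → ℝ, AnalyticAt ℝ f 0 → AnalyticAt ℝ g 0 →
        (∀ᶠ z in 𝓝 (0 : Fin k → ℝ), f z * g z = mono γ z * w z) →
        (∀ᶠ z in 𝓝 (0 : Fin k → ℝ), f (z - z i • Pi.single i 1) = 0) → NC f ∧ NC g := by
      intro f g hf hg h hP
      obtain ⟨f', hf', hff'⟩ := hadamard
        (ContinuousLinearMap.proj (R := ℝ) (φ := fun _ : Fin k => ℝ) i) (Pi.single i 1) hf
      have hff : ∀ᶠ z in 𝓝 (0 : Fin k → ℝ), f z = z i * f' z := by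
        filter_upwards [hff', hP] with z h1 h2
        rw [h1]
        simp only [ContinuousLinearMap.proj_apply]
        rw [h2, zero_add]
      have h3 : ∀ᶠ z in 𝓝 (0 : Fin k → ℝ), z i * (f' z * g z - mono γ' z * w z) = 0 := by
        filter_upwards [hff, h] with z h1 h2
        rw [h1, hγ', mono_add, mono_single] at h2
        linear_combination h2
      have h4 := (germ_domain (analyticAt_coord i 0)
        ((hf'.mul hg).sub ((mono_analytic γ' 0).mul hw)) h3).resolve_left (coord_ne i)
      obtain ⟨n1, n2⟩ := ih γ' f' g w hs' hf' hg hw hw0 (by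
        filter_upwards [h4] with z hz
        exact sub_eq_zero.1 hz)
      exact ⟨((NC.coord i).mul n1).congr hff, n2⟩
    have hPc : Continuous (fun z : Fin k → ℝ => z - z i • (Pi.single i 1 : Fin k → ℝ)) := by
      fun_prop
    have hP0 : Tendsto (fun z : Fin k → ℝ => z - z i • (Pi.single i 1 : Fin k → ℝ))
      (𝓝 0) (𝓝 0) := hPc.tendsto' _ _ (by simp)
    have hPa : AnalyticAt ℝ (fun z : Fin k → ℝ => z - z i • (Pi.single i 1 : Fin k → ℝ)) 0 :=
      analyticAt_id.sub ((analyticAt_coord i 0).smul analyticAt_const)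
    have hprod : ∀ᶠ z in 𝓝 (0 : Fin k → ℝ), f (z - z i • Pi.single i 1) *
        g (z - z i • Pi.single i 1) = 0 := by
      filter_upwards [hP0.eventually h] with z hz
      rw [hz, mono, Finset.prod_eq_zero (Finset.mem_univ i), zero_mul]
      simpa using hi
    have hz0 : (0 : Fin k → ℝ) - (0 : Fin k → ℝ) i • (Pi.single i 1 : Fin k → ℝ) = 0 := by simp
    rcases germ_domain (f := fun z => f (z - z i • Pi.single i 1))
      (g := fun z => g (z - z i • Pi.single i 1))
      (AnalyticAt.fun_comp (by rw [hz0]; exact hf) hPa) (AnalyticAt.fun_comp (by rw [hz0]; exact hg) hPa)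
      hprod with h1 | h1
    · exact step f g hf hg h h1
    · exact (step g f hg hf (by simpa only [mul_comm] using h) h1).symm

theorem NC.factor {k : ℕ} {f g : (Fin k → ℝ) → ℝ} (hf : AnalyticAt ℝ f 0) (hg : AnalyticAt ℝ g 0)
    (h : NC (fun z => f z * g z)) : NC f ∧ NC g := by
  obtain ⟨γ, w, hw, hw0, h⟩ := h
  exact NC.factor_aux _ γ f g w rfl hf hg hw hw0 h

theorem NC.factor_prod {k : ℕ} {ι : Type*} (s : Finset ι) (f : ι → (Fin k → ℝ) → ℝ)
    (hf : ∀ i ∈ s, AnalyticAt ℝ (f i) 0) (h : NC (fun z => ∏ i ∈ s, f i z)) :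
    ∀ i ∈ s, NC (f i) := by
  classical
  intro i hi
  refine (NC.factor (g := fun z => ∏ j ∈ s.erase i, f j z) (hf i hi) ?_ ?_).1
  · exact Finset.analyticAt_fun_prod _ fun j hj => hf j (Finset.mem_of_mem_erase hj)
  · refine h.congr (Eventually.of_forall fun z => ?_)
    exact Finset.mul_prod_erase s (fun j => f j z) hi

theorem mono_le_of_bound {k : ℕ} {α β : Fin k → ℕ} {K : ℝ}
    (h : ∀ᶠ z in 𝓝 (0 : Fin k → ℝ), (∀ i, 0 < z i) → mono α z ≤ K * mono β z) : β ≤ α := by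
  obtain ⟨r, hr, hB⟩ := Metric.eventually_nhds_iff_ball.1 h
  intro i
  by_contra hlt0
  have hlt : α i < β i := not_le.1 hlt0
  have hδ : 0 < r / 2 := by positivity
  set c1 := ∏ j ∈ Finset.univ \ {i}, (r/2) ^ α j
  set c2 := ∏ j ∈ Finset.univ \ {i}, (r/2) ^ β j
  have hc1 : 0 < c1 := Finset.prod_pos fun j _ => by positivity
  have hm : ∀ (γ : Fin k → ℕ) (t : ℝ), mono γ (Function.update (fun _ => r/2) i t) =
      t ^ γ i * ∏ j ∈ Finset.univ \ {i}, (r/2) ^ γ j := by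
    intro γ t
    rw [mono, ← Finset.mul_prod_erase _ _ (Finset.mem_univ i)]
    simp only [Function.update_self, Finset.sdiff_singleton_eq_erase]
    congr 1
    refine Finset.prod_congr rfl fun j hj => ?_
    rw [Function.update_of_ne (Finset.ne_of_mem_erase hj)]
  have key : ∀ t : ℝ, 0 < t → t < r → c1 ≤ (K * c2) * t ^ (β i - α i) := by
    intro t ht htr
    have h1 := hB (Function.update (fun _ => r/2) i t) (by
      rw [mem_ball_zero_iff, pi_norm_lt_iff hr]
      intro j
      by_cases hj : j = i
      · subst hj; simp [abs_of_pos ht, htr]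
      · rw [Function.update_of_ne hj, Real.norm_of_nonneg hδ.le]; linarith) (by
      intro j
      by_cases hj : j = i
      · subst hj; simpa using ht
      · simpa [hj] using hr)
    rw [hm, hm] at h1
    have h2 : t ^ β i = t ^ (β i - α i) * t ^ α i := by rw [← pow_add]; congr 1; omega
    rw [h2] at h1
    have h3 : 0 < t ^ α i := by positivity
    have : t ^ α i * c1 ≤ t ^ α i * ((K * c2) * t ^ (β i - α i)) := by
      calc _ ≤ _ := h1
        _ = _ := by ring
    exact le_of_mul_le_mul_left this h3
  have hlim : Tendsto (fun t : ℝ => (K * c2) * t ^ (β i - α i)) (𝓝[>] 0) (𝓝 0) := by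
    have : Continuous (fun t : ℝ => (K * c2) * t ^ (β i - α i)) := by fun_prop
    have h0 : β i - α i ≠ 0 := by omega
    exact (this.tendsto' 0 0 (by simp [h0])).mono_left nhdsWithin_le_nhds
  have hev : ∀ᶠ t in 𝓝[>] (0:ℝ), c1 ≤ (K * c2) * t ^ (β i - α i) := by
    filter_upwards [Ioo_mem_nhdsGT hr] with t ht
    exact key t ht.1 ht.2
  have := ge_of_tendsto hlim hev
  linarith

theorem mono_compare_aux {k : ℕ} {α β : Fin k → ℕ} {u v : (Fin k → ℝ) → ℝ}
    (hu : ContinuousAt u 0) (hv : ContinuousAt v 0) (hu0 : 0 < u 0) (hv0 : 0 < v 0)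
    (h : ∀ᶠ z in 𝓝 (0 : Fin k → ℝ), (∀ i, 0 < z i) → mono α z * u z ≤ mono β z * v z) :
    β ≤ α := by
  refine mono_le_of_bound (K := (2 * v 0) / (u 0 / 2)) ?_
  filter_upwards [h, hu.eventually (lt_mem_nhds (half_lt_self hu0)),
    hv.eventually (gt_mem_nhds (show v 0 < 2 * v 0 by linarith))] with z hz h1 h2 hp
  have h3 := hz hp
  have p1 := mono_pos α hp
  have p2 := mono_pos β hp
  rw [div_mul_eq_mul_div, le_div_iff₀ (by positivity)]
  calc _ ≤ mono α z * u z := by gcongr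
    _ ≤ _ := h3
    _ ≤ mono β z * (2 * v 0) := by gcongr
    _ = _ := by ring

theorem mono_compare {k : ℕ} {α β : Fin k → ℕ} {u v : (Fin k → ℝ) → ℝ}
    (hu : ContinuousAt u 0) (hv : ContinuousAt v 0) (hu0 : 0 < u 0) (hv0 : 0 < v 0)
    (h : (∀ᶠ z in 𝓝 (0 : Fin k → ℝ), mono α z * u z - mono β z * v z = 0) ∨
      NC (fun z => mono α z * u z - mono β z * v z)) : α ≤ β ∨ β ≤ α := by
  rcases h with h | ⟨γ, w, hw, hw0, h⟩
  · right
    refine mono_compare_aux hu hv hu0 hv0 ?_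
    filter_upwards [h] with z hz _
    linarith
  · rcases lt_or_gt_of_ne hw0 with hw0 | hw0
    · right
      refine mono_compare_aux hu hv hu0 hv0 ?_
      filter_upwards [h, hw.continuousAt.eventually (gt_mem_nhds hw0)] with z hz h1 hp
      have := mul_neg_of_pos_of_neg (mono_pos γ hp) h1
      linarith
    · left
      refine mono_compare_aux hv hu hv0 hu0 ?_
      filter_upwards [h, hw.continuousAt.eventually (lt_mem_nhds hw0)] with z hz h1 hp
      have := mul_pos (mono_pos γ hp) h1
      linarith
end

section
open Filter Topology
open scoped ContDiff

theorem taylor_one {d : ℕ} {c : ℕ → ℝ} {f u : ℝ → ℝ} (hu : AnalyticAt ℝ u 0)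
    (h : ∀ᶠ s in 𝓝 (0:ℝ), f s = ∑ i ∈ Finset.range d, c i * s ^ i + s ^ d * u s) :
    iteratedDeriv d f 0 = d.factorial * u 0 := by
  have hu' : ContDiffAt ℝ d u 0 := hu.contDiffAt
  have hpow : ∀ i : ℕ, ContDiffAt ℝ d (fun s : ℝ => s ^ i) 0 := fun i => by fun_prop
  rw [Filter.EventuallyEq.iteratedDeriv_eq d h, iteratedDeriv_fun_add
    (ContDiffAt.sum fun i _ => contDiffAt_const.mul (hpow i)) ((hpow d).mul hu'),
    iteratedDeriv_fun_sum (fun i _ => contDiffAt_const.mul (hpow i)),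
    iteratedDeriv_fun_mul (hpow d) hu', Finset.sum_eq_zero, Finset.sum_eq_single d]
  · simp only [iteratedDeriv_fun_pow_zero]; simp
  · intro i hi hne
    simp only [iteratedDeriv_fun_pow_zero]; simp [hne]
  · simp
  · intro i hi
    have : d ≠ i := by simp at hi; omega
    simp only [iteratedDeriv_const_mul_field, iteratedDeriv_fun_pow_zero]; simp [this]

section Slices
variable {E : Type*} [NormedAddCommGroup E] [NormedSpace ℝ E]

theorem slice_analytic {f : E × ℝ → ℝ} {x : E} {s : ℝ} (hf : AnalyticAt ℝ f (x, s)) :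
    AnalyticAt ℝ (fun t => f (x, t)) s :=
  AnalyticAt.fun_comp (g := f) (f := fun t : ℝ => (x, t)) hf (AnalyticAt.prod analyticAt_const analyticAt_id)

theorem fst_analytic {a : E → ℝ} (ha : AnalyticAt ℝ a 0) :
    AnalyticAt ℝ (fun z : E × ℝ => a z.1) 0 :=
  AnalyticAt.fun_comp (g := a) (f := fun z : E × ℝ => z.1) ha analyticAt_fst

theorem zero_slice_analytic {f : E × ℝ → ℝ} (hf : AnalyticAt ℝ f 0) :
    AnalyticAt ℝ (fun x : E => f (x, 0)) 0 :=
  AnalyticAt.fun_comp (g := f) (f := fun x : E => (x, (0:ℝ))) hf (AnalyticAt.prod analyticAt_id analyticAt_const)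

theorem taylor_y {f : E × ℝ → ℝ} (hf : AnalyticAt ℝ f 0) (d : ℕ) :
    ∃ (a : ℕ → E → ℝ) (u : E × ℝ → ℝ), (∀ i, AnalyticAt ℝ (a i) 0) ∧ AnalyticAt ℝ u 0 ∧
      (∀ᶠ z in 𝓝 (0 : E × ℝ), f z = ∑ i ∈ Finset.range d, a i z.1 * z.2 ^ i + z.2 ^ d * u z) ∧
      (∀ j < d, ∀ᶠ x in 𝓝 (0:E), iteratedDeriv j (fun s => f (x, s)) 0 = j.factorial * a j x) ∧
      (∀ᶠ x in 𝓝 (0:E), iteratedDeriv d (fun s => f (x, s)) 0 = d.factorial * u (x, 0)) := by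
  induction d with
  | zero =>
    refine ⟨fun _ _ => 0, f, fun _ => analyticAt_const, hf, by simp, by simp, by simp⟩
  | succ d ih =>
    obtain ⟨a, u, ha, hu, h1, h2, h3⟩ := ih
    obtain ⟨v, hv, huv⟩ := hadamard (ContinuousLinearMap.snd ℝ E ℝ) ((0 : E), (1:ℝ)) hu
    have huv' : ∀ᶠ z in 𝓝 (0 : E × ℝ), u z = u (z.1, 0) + z.2 * v z := by
      filter_upwards [huv] with z hz
      rw [hz]
      congr 2
      ext <;> simp
    let a' : ℕ → E → ℝ := fun i => if i < d then a i else fun x => u (x, 0)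
    have hexp : ∀ᶠ z in 𝓝 (0 : E × ℝ),
        f z = ∑ i ∈ Finset.range (d+1), a' i z.1 * z.2 ^ i + z.2 ^ (d+1) * v z := by
      filter_upwards [h1, huv'] with z h1 h4
      rw [h1, h4, Finset.sum_range_succ]
      have : ∑ i ∈ Finset.range d, a' i z.1 * z.2 ^ i = ∑ i ∈ Finset.range d, a i z.1 * z.2 ^ i := by
        refine Finset.sum_congr rfl fun i hi => ?_
        simp [a', Finset.mem_range.1 hi]
      rw [this]
      simp only [a', lt_irrefl, if_false]
      ring
    refine ⟨a', v, ?_, hv, hexp, ?_, ?_⟩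
    · intro i
      simp only [a']
      split_ifs
      · exact ha i
      · exact zero_slice_analytic hu
    · intro j hj
      by_cases hjd : j < d
      · simpa [a', hjd] using h2 j hjd
      · have : j = d := by omega
        subst this
        simpa [a'] using h3
    · have e1 : ∀ᶠ x in 𝓝 (0:E), ∀ᶠ s in 𝓝 (0:ℝ),
          f (x,s) = ∑ i ∈ Finset.range (d+1), a' i x * s ^ i + s ^ (d+1) * v (x,s) :=
        hexp.curry_nhds
      have e2 : ∀ᶠ x in 𝓝 (0:E), ∀ᶠ s in 𝓝 (0:ℝ), AnalyticAt ℝ v (x,s) :=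
        hv.eventually_analyticAt.curry_nhds
      filter_upwards [e1, e2] with x e1 e2
      exact taylor_one (slice_analytic e2.self_of_nhds) e1

theorem dy_analytic {f : E × ℝ → ℝ} (hf : AnalyticAt ℝ f 0) (j : ℕ) :
    ∃ g : E × ℝ → ℝ, AnalyticAt ℝ g 0 ∧
      ∀ᶠ z in 𝓝 (0 : E × ℝ), g z = iteratedDeriv j (fun s => f (z.1, s)) z.2 := by
  induction j with
  | zero => exact ⟨f, hf, by simp⟩
  | succ j ih =>
    obtain ⟨g, hg, h⟩ := ih
    refine ⟨fun z => fderiv ℝ g z (0, 1), 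
      AnalyticAt.fun_comp (g := fun L : (E × ℝ) →L[ℝ] ℝ => L (0, 1)) (f := fderiv ℝ g)
        ((ContinuousLinearMap.apply ℝ ℝ ((0:E), (1:ℝ))).analyticAt _) hg.fderiv, ?_⟩
    filter_upwards [h.eventually_nhds, hg.eventually_analyticAt] with z hz hgz
    rw [iteratedDeriv_succ]
    have hc : Tendsto (fun s : ℝ => (z.1, s)) (𝓝 z.2) (𝓝 z) := by
      have : Continuous (fun s : ℝ => (z.1, s)) := by fun_prop
      exact this.tendsto' _ _ rfl
    have h1 : (iteratedDeriv j fun s => f (z.1, s)) =ᶠ[𝓝 z.2] fun s => g (z.1, s) := by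
      filter_upwards [hc.eventually hz] with s hs
      exact hs.symm
    rw [h1.deriv_eq]
    have h2 : HasDerivAt (fun s : ℝ => (z.1, s)) ((0:E), (1:ℝ)) z.2 :=
      (hasDerivAt_const _ _).prodMk (hasDerivAt_id _)
    exact (HasFDerivAt.comp_hasDerivAt z.2 (f := fun s : ℝ => (z.1, s)) (l := g)
      hgz.differentiableAt.hasFDerivAt h2).deriv.symm

theorem tschirnhausen [CompleteSpace E] {f : E × ℝ → ℝ} (hf : AnalyticAt ℝ f 0) (n : ℕ)
    (h0 : iteratedDeriv n (fun s => f (0, s)) 0 = 0)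
    (h1 : iteratedDeriv (n+1) (fun s => f (0, s)) 0 ≠ 0) :
    ∃ φ : E → ℝ, AnalyticAt ℝ φ 0 ∧ φ 0 = 0 ∧
      ∀ᶠ x in 𝓝 (0:E), iteratedDeriv n (fun s => f (x, s)) (φ x) = 0 := by
  obtain ⟨g, hg, h⟩ := dy_analytic hf n
  have hg0 : g 0 = 0 := by
    have := h.self_of_nhds
    rw [this]; exact h0
  have hd : fderiv ℝ g 0 (0, 1) ≠ 0 := by
    have h2 : HasDerivAt (fun s : ℝ => ((0:E), s)) ((0:E), (1:ℝ)) 0 :=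
      (hasDerivAt_const _ _).prodMk (hasDerivAt_id _)
    have h3 := (HasFDerivAt.comp_hasDerivAt (0:ℝ) (f := fun s : ℝ => ((0:E), s)) (l := g)
      (show HasFDerivAt g (fderiv ℝ g 0) ((0:E),(0:ℝ)) from
        hg.differentiableAt.hasFDerivAt) h2).deriv
    rw [← h3]
    have h4 : (iteratedDeriv n fun s => f (0, s)) =ᶠ[𝓝 0] (g ∘ fun s : ℝ => ((0:E), s)) := by
      have hc : Tendsto (fun s : ℝ => ((0:E), s)) (𝓝 0) (𝓝 0) := by
        have : Continuous (fun s : ℝ => ((0:E), s)) := by fun_prop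
        exact this.tendsto' _ _ rfl
      filter_upwards [hc.eventually h] with s hs
      exact hs.symm
    rw [← h4.deriv_eq, ← iteratedDeriv_succ]
    exact h1
  have cdf : ContDiffAt ℝ ω g (0 : E × ℝ) := hg.contDiffAt
  have hinv : (fderiv ℝ g (0 : E × ℝ) ∘L .inr ℝ E ℝ).IsInvertible := by
    refine ⟨ContinuousLinearEquiv.unitsEquivAut ℝ (Units.mk0 _ hd), ?_⟩
    ext
    simp
  refine ⟨cdf.implicitFunction (by simp) hinv, ?_, cdf.implicitFunction_apply_self _ hinv, ?_⟩
  · exact ContDiffAt.analyticAt (cdf.contDiffAt_implicitFunction (by simp) hinv)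
  · have hcont : ContinuousAt (cdf.implicitFunction (by simp) hinv) (0:E) :=
      (cdf.contDiffAt_implicitFunction (by simp) hinv).continuousAt
    have ht : Tendsto (fun x => (x, cdf.implicitFunction (by simp) hinv x)) (𝓝 (0:E))
        (𝓝 (0 : E × ℝ)) := by
      have h5 : Tendsto (cdf.implicitFunction (by simp) hinv) (𝓝 (0:E)) (𝓝 (0:ℝ)) := by
        have h6 := hcont.tendsto
        rwa [show cdf.implicitFunction (by simp) hinv (0:E) = 0 from
          cdf.implicitFunction_apply_self _ hinv] at h6
      exact Filter.Tendsto.prodMk_nhds tendsto_id h5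
    filter_upwards [cdf.eventually_apply_implicitFunction (by simp) hinv, ht.eventually h] with x e1 e2
    rw [← e2, e1, hg0]
end Slices
end

section
open Filter Topology

section Lifts
variable {E F G : Type*} [NormedAddCommGroup E] [NormedSpace ℝ E]
  [NormedAddCommGroup F] [NormedSpace ℝ F] [NormedAddCommGroup G] [NormedSpace ℝ G]

def Lift (l : Filter ℕ) (s : G → F) (q : ℕ → G) (p : ℕ → F) : Prop :=
  AnalyticAt ℝ s 0 ∧ s 0 = 0 ∧ Tendsto q l (𝓝 0) ∧ ∀ᶠ n in l, s (q n) = p n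

theorem Lift.comp {l : Filter ℕ} {s : G → F} {t : E → G} {q : ℕ → G} {p : ℕ → F} {r : ℕ → E}
    (hs : Lift l s q p) (ht : Lift l t r q) : Lift l (fun z => s (t z)) r p := by
  obtain ⟨a1, a2, a3, a4⟩ := hs
  obtain ⟨b1, b2, b3, b4⟩ := ht
  refine ⟨AnalyticAt.fun_comp (g := s) (f := t) (by rw [b2]; exact a1) b1, by simp only [b2, a2], b3, ?_⟩
  filter_upwards [a4, b4] with n h1 h2
  rw [h2, h1]

theorem Lift.tendsto {l : Filter ℕ} {s : G → F} {q : ℕ → G} {p : ℕ → F} (hs : Lift l s q p) :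
    Tendsto s (𝓝 0) (𝓝 0) := by
  have := hs.1.continuousAt.tendsto
  rwa [hs.2.1] at this

theorem Lift.analytic {l : Filter ℕ} {s : G → F} {q : ℕ → G} {p : ℕ → F} (hs : Lift l s q p)
    {f : F → ℝ} (hf : AnalyticAt ℝ f 0) : AnalyticAt ℝ (fun z => f (s z)) 0 :=
  AnalyticAt.fun_comp (g := f) (f := s) (by rw [hs.2.1]; exact hf) hs.1

def Res (k : ℕ) (f : F → ℝ) (l : Filter ℕ) (p : ℕ → F) : Prop :=
  ∃ (s : (Fin k → ℝ) → F) (q : ℕ → (Fin k → ℝ)), Lift l s q p ∧ NC (fun z => f (s z))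

theorem Res.pull {k : ℕ} {f : F → ℝ} {l : Filter ℕ} {s : G → F} {q : ℕ → G} {p : ℕ → F}
    (hs : Lift l s q p) (h : Res k (fun z => f (s z)) l q) : Res k f l p := by
  obtain ⟨t, r, ht, hn⟩ := h
  exact ⟨fun z => s (t z), r, hs.comp ht, hn⟩

theorem Res.congr {k : ℕ} {f g : F → ℝ} {l : Filter ℕ} {p : ℕ → F}
    (h : Res k f l p) (hfg : ∀ᶠ z in 𝓝 0, g z = f z) : Res k g l p := by
  obtain ⟨t, r, ht, hn⟩ := h
  exact ⟨t, r, ht, hn.congr (ht.tendsto.eventually hfg)⟩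

theorem Lift.extend {l : Filter ℕ} {s : G → F} {q : ℕ → G} {p : ℕ → F × ℝ}
    (hp : Tendsto p l (𝓝 0)) (hs : Lift l s q (fun n => (p n).1)) :
    Lift l (fun z : G × ℝ => (s z.1, z.2)) (fun n => (q n, (p n).2)) p := by
  refine ⟨AnalyticAt.prod (AnalyticAt.fun_comp (g := s) (f := fun z : G × ℝ => z.1) hs.1 analyticAt_fst)
    analyticAt_snd, by simp [hs.2.1], ?_, ?_⟩
  · exact hs.2.2.1.prodMk_nhds ((continuous_snd.tendsto _).comp hp)
  · filter_upwards [hs.2.2.2] with n hn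
    ext <;> simp [hn]

end Lifts

theorem ultra_lim {𝒰 : Ultrafilter ℕ} {g : ℕ → ℝ} {C : ℝ} (h : ∀ᶠ n in (𝒰 : Filter ℕ), |g n| ≤ C) :
    ∃ a, Tendsto g 𝒰 (𝓝 a) := by
  obtain ⟨a, -, ha⟩ := (isCompact_Icc (a := -C) (b := C)).ultrafilter_le_nhds (𝒰.map g) (by
    rw [le_principal_iff]
    have h2 : ∀ᶠ n in (𝒰 : Filter ℕ), g n ∈ Set.Icc (-C) C := by
      filter_upwards [h] with n hn
      exact abs_le.1 hn
    exact h2)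
  exact ⟨a, ha⟩

/-- coordinates on the product -/
def spl {m : ℕ} (z : Fin (m+1) → ℝ) : (Fin m → ℝ) × ℝ := (fun i => z i.succ, z 0)

def unspl {m : ℕ} (z : (Fin m → ℝ) × ℝ) : Fin (m+1) → ℝ := Fin.cons z.2 z.1

theorem spl_unspl {m : ℕ} (z : (Fin m → ℝ) × ℝ) : spl (unspl z) = z := by
  ext <;> simp [spl, unspl]

theorem analyticAt_pi' {k : ℕ} {F : Type*} [NormedAddCommGroup F] [NormedSpace ℝ F]
    {f : F → Fin k → ℝ} {x : F} (h : ∀ i, AnalyticAt ℝ (fun z => f z i) x) : AnalyticAt ℝ f x :=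
  analyticAt_pi_iff.2 h

theorem spl_analytic {m : ℕ} (z : Fin (m+1) → ℝ) : AnalyticAt ℝ (spl (m := m)) z :=
  AnalyticAt.prod (analyticAt_pi' fun i => analyticAt_coord i.succ z) (analyticAt_coord 0 z)

theorem spl_lift {m : ℕ} {l : Filter ℕ} {p : ℕ → (Fin m → ℝ) × ℝ} (hp : Tendsto p l (𝓝 0)) :
    Lift l (spl (m := m)) (fun n => unspl (p n)) p := by
  refine ⟨spl_analytic 0, rfl, ?_, by simp [spl_unspl]⟩
  rw [tendsto_pi_nhds]
  intro i
  refine Fin.cases ?_ (fun j => ?_) i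
  · exact (continuous_snd.tendsto _).comp hp
  · exact ((continuous_apply j).tendsto _).comp ((continuous_fst.tendsto _).comp hp)

theorem NC.fst {m : ℕ} {h : (Fin m → ℝ) → ℝ} (hh : NC h) :
    NC (fun z : Fin (m+1) → ℝ => h (spl z).1) := by
  obtain ⟨α, u, hu, hu0, h1⟩ := hh
  refine ⟨Fin.cons 0 α, fun z => u (spl z).1, ?_, hu0, ?_⟩
  · exact AnalyticAt.fun_comp (g := fun y : (Fin m → ℝ) × ℝ => u y.1) (f := spl) (fst_analytic hu)
      (spl_analytic 0)
  · have ht : Tendsto (fun z : Fin (m+1) → ℝ => (spl z).1) (𝓝 0) (𝓝 0) := by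
      have : Continuous (fun z : Fin (m+1) → ℝ => (spl z).1) := by unfold spl; fun_prop
      exact this.tendsto' _ _ rfl
    filter_upwards [ht.eventually h1] with z hz
    rw [hz]
    simp [mono, Fin.prod_univ_succ, spl]

theorem NC.snd {m : ℕ} : NC (fun z : Fin (m+1) → ℝ => (spl z).2) := NC.coord 0

theorem Res.spl {m : ℕ} {l : Filter ℕ} {p : ℕ → (Fin m → ℝ) × ℝ} (hp : Tendsto p l (𝓝 0))
    {g h : (Fin m → ℝ) × ℝ → ℝ} {h' : (Fin m → ℝ) → ℝ} {d : ℕ} (hh : NC h')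
    (hg : AnalyticAt ℝ g 0) (hg0 : g 0 ≠ 0)
    (he : ∀ᶠ z in 𝓝 0, h z = z.2 ^ d * g z * h' z.1) : Res (m+1) h l p := by
  refine Res.congr ⟨_, _, spl_lift hp, ?_⟩ he
  exact ((NC.snd.pow d).mul (NC.unit ((spl_lift hp).analytic hg) hg0)).mul hh.fst

theorem NC.mono_comp {k m : ℕ} (ρ : Fin m → ℕ) {s : (Fin k → ℝ) → (Fin m → ℝ)}
    (h : ∀ i, NC (fun z => s z i)) : NC (fun z => mono ρ (s z)) :=
  NC.prod Finset.univ (fun i z => s z i ^ ρ i) fun i _ => (h i).pow _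

theorem lemma_T {m : ℕ} {𝒰 : Ultrafilter ℕ} (s : ℕ) : ∀ (ρ : Fin m → ℕ), ∑ i, ρ i = s →
    ∀ p : ℕ → (Fin m → ℝ) × ℝ, Tendsto p 𝒰 (𝓝 0) →
    (∀ C : ℝ, ∀ᶠ n in (𝒰 : Filter ℕ), C * |mono ρ (p n).1| < |(p n).2|) →
    ∃ (τ : (Fin (m+1) → ℝ) → (Fin m → ℝ) × ℝ) (q : ℕ → (Fin (m+1) → ℝ)), Lift 𝒰 τ q p ∧
      (∀ i, NC (fun z => (τ z).1 i)) ∧ NC (fun z => (τ z).2) ∧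
      ∃ w : (Fin (m+1) → ℝ) → ℝ, AnalyticAt ℝ w 0 ∧ w 0 = 0 ∧
        ∀ᶠ z in 𝓝 (0 : Fin (m+1) → ℝ), mono ρ (τ z).1 = (τ z).2 * w z := by
  classical
  induction s with
  | zero =>
    intro ρ hρ p hp hB
    exfalso
    have hρ0 : ρ = 0 := by
      funext i
      exact (Finset.sum_eq_zero_iff.1 hρ) i (Finset.mem_univ i)
    subst hρ0
    have h1 : Tendsto (fun n => |(p n).2|) 𝒰 (𝓝 0) := by
      have := ((continuous_snd.tendsto _).comp hp).abs
      simpa using this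
    obtain ⟨n, hn1, hn2⟩ := ((hB 1).and (h1.eventually (gt_mem_nhds one_pos))).exists
    simp [mono_zero] at hn1
    linarith
  | succ s ih =>
    intro ρ hρ p hp hB
    obtain ⟨i, hi⟩ : ∃ i, ρ i ≠ 0 := by
      by_contra! h
      simp [h] at hρ
    obtain ⟨ρ', rfl⟩ : ∃ ρ' : Fin m → ℕ, ρ = (Pi.single i 1 : Fin m → ℕ) + ρ' := by
      refine ⟨fun j => ρ j - (Pi.single i 1 : Fin m → ℕ) j, ?_⟩
      funext j
      by_cases hj : j = i
      · subst hj
        simp only [Pi.add_apply, Pi.single_eq_same]; omega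
      · simp only [Pi.add_apply, Pi.single_eq_of_ne hj]; omega
    have hρ' : ∑ j, ρ' j = s := by
      simp [Finset.sum_add_distrib] at hρ; omega
    have hmono : ∀ x : Fin m → ℝ, mono (Pi.single i 1 + ρ') x = x i * mono ρ' x := by
      intro x; rw [mono_add, mono_single, pow_one]
    have hx0 : Tendsto (fun n => (p n).1) 𝒰 (𝓝 0) := (continuous_fst.tendsto _).comp hp
    have hy0 : Tendsto (fun n => (p n).2) 𝒰 (𝓝 0) := (continuous_snd.tendsto _).comp hp
    have hyne : ∀ᶠ n in (𝒰 : Filter ℕ), (p n).2 ≠ 0 := by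
      filter_upwards [hB 0] with n hn
      simpa using hn
    by_cases hC : ∃ C : ℝ, ∀ᶠ n in (𝒰 : Filter ℕ), |(p n).1 i| ≤ C * |(p n).2|
    · obtain ⟨C, hC⟩ := hC
      obtain ⟨μ, hμ⟩ : ∃ μ, Tendsto (fun n => (p n).1 i / (p n).2) 𝒰 (𝓝 μ) := by
        refine ultra_lim (C := C) ?_
        filter_upwards [hC, hyne] with n h1 h2
        rw [abs_div, div_le_iff₀ (abs_pos.2 h2)]
        exact h1
      let t : (Fin m → ℝ) × ℝ → (Fin m → ℝ) × ℝ := fun z =>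
        (fun j => if j = i then z.2 * (μ + z.1 i) else z.1 j, z.2)
      let r : ℕ → (Fin m → ℝ) × ℝ := fun n =>
        (fun j => if j = i then (p n).1 i / (p n).2 - μ else (p n).1 j, (p n).2)
      have hcoord : ∀ j, AnalyticAt ℝ (fun z : (Fin m → ℝ) × ℝ => z.1 j) 0 := fun j =>
        fst_analytic (analyticAt_coord j 0)
      have hr0 : Tendsto r 𝒰 (𝓝 0) := by
        refine Tendsto.prodMk_nhds (tendsto_pi_nhds.2 fun j => ?_) hy0
        by_cases hj : j = i
        · subst hj
          simpa using hμ.sub_const μ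
        · simpa [hj] using (tendsto_pi_nhds.1 hx0 j)
      have hL : Lift 𝒰 t r p := by
        refine ⟨AnalyticAt.prod (analyticAt_pi' fun j => ?_) analyticAt_snd, ?_, hr0, ?_⟩
        · by_cases hj : j = i
          · subst hj
            simpa using analyticAt_snd.fun_mul (analyticAt_const.fun_add (hcoord j))
          · simpa [hj] using hcoord j
        · ext j
          · by_cases hj : j = i <;> simp [t, hj]
          · simp [t]
        · filter_upwards [hyne] with n hn
          ext j
          · by_cases hj : j = i
            · subst hj; simp [t, r]; field_simp
            · simp [t, r, hj]
          · simp [t, r]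
      have hLL := hL.comp (spl_lift hr0)
      let w0 : (Fin m → ℝ) × ℝ → ℝ := fun z => (μ + z.1 i) * mono ρ' (t z).1
      have hw0 : AnalyticAt ℝ w0 0 :=
        (analyticAt_const.add (hcoord i)).mul (hL.analytic (fst_analytic (mono_analytic ρ' 0)))
      have hw : ∀ z, mono (Pi.single i 1 + ρ') (t z).1 = (t z).2 * w0 z := by
        intro z
        rw [hmono]
        simp [t, w0]; ring
      have hw00 : w0 0 = 0 := by
        have h1 : Tendsto (fun n => w0 (r n)) 𝒰 (𝓝 (w0 0)) := hw0.continuousAt.tendsto.comp hr0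
        have h2 : Tendsto (fun n => w0 (r n)) 𝒰 (𝓝 0) := by
          rw [Metric.tendsto_nhds]
          intro ε hε
          filter_upwards [hB ε⁻¹, hL.2.2.2, hyne] with n h1 h2 h3
          have h4 := hw (r n)
          rw [h2] at h4
          rw [h4, abs_mul, inv_mul_lt_iff₀ hε, mul_comm ε] at h1
          simpa using lt_of_mul_lt_mul_left h1 (abs_nonneg _)
        exact tendsto_nhds_unique h1 h2
      refine ⟨_, _, hLL, ?_, ?_, fun z => w0 (spl z), (spl_lift hr0).analytic hw0, hw00, ?_⟩
      · intro j
        by_cases hj : j = i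
        · subst hj
          simp only [t, if_true]
          refine NC.mul NC.snd ?_
          by_cases hμ0 : μ = 0
          · simpa [hμ0] using (NC.coord j).fst
          · exact NC.unit ((spl_lift hr0).analytic (analyticAt_const.add (hcoord j))) (by simpa [spl] using hμ0)
        · simp only [t, hj, if_false]
          exact (NC.coord j).fst
      · exact NC.snd
      · exact Eventually.of_forall fun z => hw (spl z)
    · push Not at hC
      have hC' : ∀ C : ℝ, ∀ᶠ n in (𝒰 : Filter ℕ), C * |(p n).2| < |(p n).1 i| := by
        intro C
        exact hC C
      have hxne : ∀ᶠ n in (𝒰 : Filter ℕ), (p n).1 i ≠ 0 := by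
        filter_upwards [hC' 0] with n hn
        simpa using hn
      let t : (Fin m → ℝ) × ℝ → (Fin m → ℝ) × ℝ := fun z => (z.1, z.1 i * z.2)
      let r : ℕ → (Fin m → ℝ) × ℝ := fun n => ((p n).1, (p n).2 / (p n).1 i)
      have hr0 : Tendsto r 𝒰 (𝓝 0) := by
        refine Tendsto.prodMk_nhds hx0 ?_
        rw [Metric.tendsto_nhds]
        intro ε hε
        filter_upwards [hC' ε⁻¹, hxne] with n h1 h2
        rw [inv_mul_lt_iff₀ hε] at h1
        simp only [dist_zero_right, Real.norm_eq_abs, abs_div]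
        rw [div_lt_iff₀ (abs_pos.2 h2)]
        exact h1
      have hL : Lift 𝒰 t r p := by
        refine ⟨AnalyticAt.prod analyticAt_fst
          ((fst_analytic (analyticAt_coord i 0)).mul analyticAt_snd), by simp [t], hr0, ?_⟩
        filter_upwards [hxne] with n hn
        ext j
        · simp [t, r]
        · simp [t, r]; field_simp
      obtain ⟨τ, q, h1, h2, h3, w, hw, hw0, h4⟩ := ih ρ' hρ' r hr0 (by
        intro C
        filter_upwards [hB C, hxne] with n h1 h2
        rw [hmono, abs_mul] at h1
        simp only [r, abs_div]
        rw [lt_div_iff₀ (abs_pos.2 h2)]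
        linarith)
      refine ⟨_, _, hL.comp h1, h2, (h2 i).mul h3, w, hw, hw0, ?_⟩
      filter_upwards [h4] with z hz
      simp only [t]
      rw [hmono, hz]; ring

theorem pow_lift {m : ℕ} {𝒰 : Ultrafilter ℕ} {N : ℕ} (hN : N ≠ 0) {p : ℕ → Fin m → ℝ}
    (hp : Tendsto p 𝒰 (𝓝 0)) : ∃ (s : (Fin m → ℝ) → Fin m → ℝ) (q : ℕ → Fin m → ℝ),
    Lift 𝒰 s q p ∧ ∀ (α : Fin m → ℕ) (g : (Fin m → ℝ) → ℝ), NCw α g → NCw (N • α) (fun z => g (s z)) := by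
  have hε : ∀ i, ∃ ε : ℝ, ε ≠ 0 ∧ ∀ᶠ n in (𝒰 : Filter ℕ), p n i = ε * |p n i| := by
    intro i
    by_cases h : ∀ᶠ n in (𝒰 : Filter ℕ), 0 ≤ p n i
    · refine ⟨1, one_ne_zero, ?_⟩
      filter_upwards [h] with n hn
      rw [abs_of_nonneg hn, one_mul]
    · rw [← Ultrafilter.eventually_not] at h
      refine ⟨-1, by norm_num, ?_⟩
      filter_upwards [h] with n hn
      rw [abs_of_neg (not_le.1 hn)]; ring
  choose ε hε0 hε using hε
  let s : (Fin m → ℝ) → Fin m → ℝ := fun z i => ε i * z i ^ N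
  have hL : Lift 𝒰 s (fun n i => |p n i| ^ ((N:ℝ)⁻¹)) p := by
    refine ⟨analyticAt_pi' fun i => analyticAt_const.mul ((analyticAt_coord i 0).pow N), ?_, ?_, ?_⟩
    · funext i; simp [s, hN]
    · rw [tendsto_pi_nhds]
      intro i
      have h1 : Tendsto (fun n => |p n i|) 𝒰 (𝓝 0) := by
        simpa using (((continuous_apply i).tendsto _).comp hp).abs
      have h2 := h1.rpow_const (p := (N:ℝ)⁻¹) (Or.inr (by positivity))
      simpa [Real.zero_rpow, hN] using h2
    · filter_upwards [eventually_all.2 hε] with n hn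
      funext i
      simp only [s]
      rw [Real.rpow_inv_natCast_pow (abs_nonneg _) hN]
      exact (hn i).symm
  refine ⟨s, _, hL, ?_⟩
  rintro α g ⟨u, hu, hu0, h⟩
  refine ⟨fun z => mono α ε * u (s z), analyticAt_const.mul (hL.analytic hu), ?_, ?_⟩
  · refine mul_ne_zero (Finset.prod_ne_zero_iff.2 fun i _ => pow_ne_zero _ (hε0 i)) ?_
    rw [hL.2.1]; exact hu0
  · filter_upwards [hL.tendsto.eventually h] with z hz
    rw [hz]
    have : mono α (s z) = mono α ε * mono (N • α) z := by
      rw [mono_smul]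
      simp only [mono, s, mul_pow, Finset.prod_mul_distrib, ← pow_mul, mul_comm N]
      congr 1
      rw [← Finset.prod_pow]
      simp [pow_mul]
    rw [this]; ring
end

section
open Filter Topology

theorem iteratedDeriv_poly (Q : Polynomial ℝ) (d : ℕ) :
    iteratedDeriv d (fun s => Q.eval s) = fun s => (Polynomial.derivative^[d] Q).eval s := by
  induction d with
  | zero => simp
  | succ d ih =>
    rw [iteratedDeriv_succ, ih, Function.iterate_succ_apply']
    funext s
    exact Polynomial.deriv _

theorem exists_small_deriv {n : ℕ} (b : ℕ → ℝ) (c a : ℝ) {i0 : ℕ} (hi0 : i0 < n) (hb : b i0 ≠ 0) :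
    ∃ d < n + 1, iteratedDeriv d
      (fun s : ℝ => ∑ i ∈ Finset.range n, b i * (a + s) ^ i + (a + s) ^ (n+1) * c) 0 ≠ 0 := by
  open Polynomial in
  let P : ℝ[X] := ∑ i ∈ Finset.range n, C (b i) * X ^ i + C c * X ^ (n+1)
  let Q : ℝ[X] := P.comp (X + C a)
  have hQ : (fun s : ℝ => ∑ i ∈ Finset.range n, b i * (a + s) ^ i + (a + s) ^ (n+1) * c) =
      fun s => Q.eval s := by
    funext s
    simp only [Q, P, Polynomial.eval_comp, Polynomial.eval_add, Polynomial.eval_finsetSum, Polynomial.eval_mul,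
      Polynomial.eval_C, Polynomial.eval_pow, Polynomial.eval_X, add_comm s a, mul_comm c]
  have hPc : ∀ k, P.coeff k = (if k < n then b k else 0) + if k = n + 1 then c else 0 := by
    intro k
    simp only [P, Polynomial.coeff_add, Polynomial.finsetSum_coeff, Polynomial.coeff_C_mul_X_pow]
    simp
  by_contra! hcon
  have hq : ∀ d < n + 1, Q.coeff d = 0 := by
    intro d hd
    have h1 := hcon d hd
    rw [hQ, iteratedDeriv_poly] at h1
    simp only at h1
    rw [← Polynomial.coeff_zero_eq_eval_zero, Polynomial.coeff_iterate_derivative] at h1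
    simp only [zero_add, Nat.descFactorial_self, nsmul_eq_mul, mul_eq_zero, Nat.cast_eq_zero] at h1
    exact h1.resolve_left (Nat.factorial_ne_zero d)
  have hPd : P.natDegree ≤ n + 1 := by
    rw [Polynomial.natDegree_le_iff_coeff_eq_zero]
    intro k hk
    rw [hPc, if_neg (by omega), if_neg (by omega), add_zero]
  have hQd : Q.natDegree ≤ n + 1 := by
    refine Polynomial.natDegree_comp_le.trans ?_
    rw [Polynomial.natDegree_X_add_C, mul_one]; exact hPd
  have hQe : Q = Polynomial.C (Q.coeff (n+1)) * Polynomial.X ^ (n+1) := by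
    ext k
    rw [Polynomial.coeff_C_mul_X_pow]
    rcases lt_trichotomy k (n+1) with h | h | h
    · rw [hq k h, if_neg (by omega)]
    · simp [h]
    · rw [if_neg (by omega)]
      exact Polynomial.coeff_eq_zero_of_natDegree_lt (lt_of_le_of_lt hQd h)
  have hPQ : P = Polynomial.C (Q.coeff (n+1)) * (Polynomial.X - Polynomial.C a) ^ (n+1) := by
    have h1 : P = Q.comp (Polynomial.X - Polynomial.C a) := by
      simp [Q, Polynomial.comp_assoc]
    rw [h1, hQe]
    simp
  have hcoef : ∀ k, P.coeff k = Q.coeff (n+1) * ((-a)^(n+1-k) * ((n+1).choose k : ℝ)) := by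
    intro k
    conv_lhs => rw [hPQ]
    rw [Polynomial.coeff_C_mul, sub_eq_add_neg, ← Polynomial.C_neg, Polynomial.coeff_X_add_C_pow]
  have e1 := hcoef n
  rw [hPc, if_neg (by omega), if_neg (by omega)] at e1
  have e2 := hcoef i0
  rw [hPc, if_pos hi0, if_neg (by omega), add_zero] at e2
  have hq0 : Q.coeff (n+1) ≠ 0 := by
    intro h; rw [h, zero_mul] at e2; exact hb e2
  have ha : a = 0 := by
    have h3 : n + 1 - n = 1 := by omega
    rw [h3] at e1
    simp only [Nat.choose_succ_self_right] at e1
    have h4 := (mul_eq_zero.1 (e1.symm.trans (by simp))).resolve_left hq0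
    have h5 := (mul_eq_zero.1 h4).resolve_right (by positivity)
    simpa using h5
  rw [ha, neg_zero, zero_pow (by omega)] at e2
  exact hb (by rw [e2]; ring)

theorem Lift.ne {F G : Type*} [NormedAddCommGroup F] [NormedSpace ℝ F] [NormedAddCommGroup G]
    [NormedSpace ℝ G] {l : Filter ℕ} {s : G → F} {q : ℕ → G} {p : ℕ → F} (hs : Lift l s q p)
    {f : F → ℝ} (hf : f 0 ≠ 0) : f (s 0) ≠ 0 := by rw [hs.2.1]; exact hf

def Mon (m : ℕ) : Prop := ∀ (𝒰 : Ultrafilter ℕ) (f : (Fin m → ℝ) → ℝ) (p : ℕ → Fin m → ℝ),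
  AnalyticAt ℝ f 0 → (¬ ∀ᶠ z in 𝓝 (0 : Fin m → ℝ), f z = 0) → Tendsto p 𝒰 (𝓝 0) → Res m f 𝒰 p

def VP (m d : ℕ) : Prop := ∀ (𝒰 : Ultrafilter ℕ) (f : (Fin m → ℝ) × ℝ → ℝ) (h : (Fin m → ℝ) → ℝ)
  (p : ℕ → (Fin m → ℝ) × ℝ), AnalyticAt ℝ f 0 → AnalyticAt ℝ h 0 →
  iteratedDeriv d (fun s => f (0, s)) 0 ≠ 0 → (¬ ∀ᶠ x in 𝓝 (0 : Fin m → ℝ), h x = 0) →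
  Tendsto p 𝒰 (𝓝 0) → Res (m+1) (fun z => f z * h z.1) 𝒰 p

theorem V_step {m n : ℕ} (IH : ∀ d < n + 1, VP m d) (𝒰 : Ultrafilter ℕ) {ρ : Fin m → ℕ} (hρ : ρ ≠ 0)
    (b : ℕ → (Fin m → ℝ) → ℝ) (hb : ∀ i, AnalyticAt ℝ (b i) 0) (u : (Fin m → ℝ) × ℝ → ℝ)
    (hu : AnalyticAt ℝ u 0) (hu0 : u 0 ≠ 0) (h : (Fin m → ℝ) → ℝ) (hh : AnalyticAt ℝ h 0)
    (hNC : NC h) {i0 : ℕ} (hi0 : i0 < n) (hbi : b i0 0 ≠ 0) (p : ℕ → (Fin m → ℝ) × ℝ)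
    (hp : Tendsto p 𝒰 (𝓝 0)) :
    Res (m+1) (fun z => (∑ i ∈ Finset.range n, mono ((n+1-i) • ρ) z.1 * b i z.1 * z.2 ^ i
      + z.2 ^ (n+1) * u z) * h z.1) 𝒰 p := by
  have hx0 : Tendsto (fun n => (p n).1) 𝒰 (𝓝 0) := (continuous_fst.tendsto _).comp hp
  by_cases hC : ∃ C : ℝ, ∀ᶠ n in (𝒰 : Filter ℕ), |(p n).2| ≤ C * |mono ρ (p n).1|
  · obtain ⟨C, hC⟩ := hC
    obtain ⟨a, ha⟩ : ∃ a, Tendsto (fun n => (p n).2 / mono ρ (p n).1) 𝒰 (𝓝 a) := by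
      refine ultra_lim (C := |C|) ?_
      filter_upwards [hC] with n h1
      by_cases h2 : mono ρ (p n).1 = 0
      · simp [h2]
      · rw [abs_div, div_le_iff₀ (abs_pos.2 h2)]
        refine h1.trans ?_
        gcongr
        exact le_abs_self C
    let t : (Fin m → ℝ) × ℝ → (Fin m → ℝ) × ℝ := fun z => (z.1, mono ρ z.1 * (a + z.2))
    have hr0 : Tendsto (fun n => ((p n).1, (p n).2 / mono ρ (p n).1 - a)) 𝒰 (𝓝 0) := by
      refine Tendsto.prodMk_nhds hx0 ?_
      simpa using ha.sub_const a
    have hL : Lift 𝒰 t (fun n => ((p n).1, (p n).2 / mono ρ (p n).1 - a)) p := by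
      refine ⟨AnalyticAt.prod analyticAt_fst ((fst_analytic (mono_analytic ρ 0)).fun_mul
        (analyticAt_const.fun_add analyticAt_snd)), ?_, hr0, ?_⟩
      · simp [t, mono_at_zero hρ]
      · filter_upwards [hC] with n h1
        ext j
        · simp [t]
        · simp only [t]
          by_cases h2 : mono ρ (p n).1 = 0
          · rw [h2] at h1
            have : (p n).2 = 0 := by simpa using h1
            simp [h2, this]
          · field_simp; ring
    refine Res.pull hL ?_
    let g : (Fin m → ℝ) × ℝ → ℝ := fun z =>
      ∑ i ∈ Finset.range n, b i z.1 * (a + z.2) ^ i + (a + z.2) ^ (n+1) * u (t z)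
    have hay : AnalyticAt ℝ (fun z : (Fin m → ℝ) × ℝ => a + z.2) 0 :=
      analyticAt_const.fun_add analyticAt_snd
    have hg : AnalyticAt ℝ g 0 := by
      refine AnalyticAt.fun_add (Finset.analyticAt_fun_sum _ fun i _ => ?_) ?_
      · exact (fst_analytic (hb i)).fun_mul (hay.fun_pow i)
      · exact (hay.fun_pow _).fun_mul (hL.analytic hu)
    obtain ⟨d, hd, hder⟩ := exists_small_deriv (fun i => b i 0) (u 0) a hi0 hbi
    have hg0 : (fun s : ℝ => g (0, s)) = fun s : ℝ =>
        ∑ i ∈ Finset.range n, b i 0 * (a + s) ^ i + (a + s) ^ (n+1) * u 0 := by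
      funext s
      simp only [g, t, mono_at_zero hρ, zero_mul]
      rfl
    rw [← hg0] at hder
    refine (IH d hd 𝒰 g (fun x => mono ((n+1) • ρ) x * h x) _ hg
      ((mono_analytic _ _).fun_mul hh) hder
      (germ_mul_ne (mono_analytic _ _) hh (mono_ne _) hNC.ne) hr0).congr
      (Eventually.of_forall fun z => ?_)
    have : ∑ i ∈ Finset.range n, mono ((n+1-i) • ρ) z.1 * b i z.1 * (mono ρ z.1 * (a + z.2)) ^ i =
        mono ((n+1) • ρ) z.1 * ∑ i ∈ Finset.range n, b i z.1 * (a + z.2) ^ i := by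
      rw [Finset.mul_sum]
      refine Finset.sum_congr rfl fun i hi => ?_
      have hi : i < n := Finset.mem_range.1 hi
      have h1 : n + 1 = (n + 1 - i) + i := by omega
      conv_rhs => rw [h1]
      simp only [mono_smul, mul_pow, pow_add]
      ring
    simp only [t, g] at this ⊢
    rw [this]
    simp only [mono_smul, mul_pow]
    ring
  · push Not at hC
    obtain ⟨τ, q, hL, h1, h2, w, hw, hw0, h3⟩ := lemma_T _ ρ rfl p hp (fun C => hC C)
    refine ⟨τ, q, hL, ?_⟩
    have hbr : NC (fun z => ∑ i ∈ Finset.range n, w z ^ (n+1-i) * b i (τ z).1 + u (τ z)) := by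
      refine NC.unit (AnalyticAt.fun_add (Finset.analyticAt_fun_sum _ fun i _ => ?_) (hL.analytic hu)) ?_
      · exact (hw.fun_pow _).fun_mul (hL.analytic (fst_analytic (hb i)))
      · rw [Finset.sum_eq_zero, zero_add, hL.2.1]
        · exact hu0
        · intro i hi
          have hi : i < n := Finset.mem_range.1 hi
          rw [hw0, zero_pow (by omega), zero_mul]
    have hhN : NC (fun z => h (τ z).1) := by
      obtain ⟨α, v, hv, hv0, h4⟩ := hNC
      have ht : Tendsto (fun z => (τ z).1) (𝓝 0) (𝓝 0) :=
        (continuous_fst.tendsto (0 : (Fin m → ℝ) × ℝ)).comp hL.tendsto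
      refine ((NC.mono_comp α h1).mul (NC.unit (hL.analytic (fst_analytic hv)) ?_)).congr
        (ht.eventually h4)
      rw [hL.2.1]; exact hv0
    refine (((h2.pow (n+1)).mul hbr).mul hhN).congr ?_
    filter_upwards [h3] with z hz
    congr 1
    rw [mul_add, Finset.mul_sum]
    congr 1
    refine Finset.sum_congr rfl fun i hi => ?_
    have hi : i < n := Finset.mem_range.1 hi
    have h1 : n + 1 = (n + 1 - i) + i := by omega
    rw [mono_smul, hz, mul_pow]
    conv_rhs => rw [h1]
    rw [pow_add]
    simp only [Nat.add_sub_cancel_right]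
    ring

theorem V_tsch {m n : ℕ} (hM : Mon m) (IH : ∀ d < n + 1, VP m d) (𝒰 : Ultrafilter ℕ)
    (f : (Fin m → ℝ) × ℝ → ℝ) (h : (Fin m → ℝ) → ℝ)
    (p : ℕ → (Fin m → ℝ) × ℝ) (hf : AnalyticAt ℝ f 0) (hh : AnalyticAt ℝ h 0)
    (hd : iteratedDeriv (n+1) (fun s => f (0, s)) 0 ≠ 0)
    (hlow : ∀ j < n + 1, iteratedDeriv j (fun s => f (0, s)) 0 = 0)
    (hn : ∀ᶠ x in 𝓝 (0 : Fin m → ℝ), iteratedDeriv n (fun s => f (x, s)) 0 = 0)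
    (hh0 : ¬ ∀ᶠ x in 𝓝 (0 : Fin m → ℝ), h x = 0)
    (hp : Tendsto p 𝒰 (𝓝 0)) : Res (m+1) (fun z => f z * h z.1) 𝒰 p := by
  classical
  obtain ⟨a, u, ha, hu, hexp, hcoef, hlead⟩ := taylor_y hf (n+1)
  have hu0 : u 0 ≠ 0 := by
    intro h0
    have := hlead.self_of_nhds
    rw [show ((0 : Fin m → ℝ), (0:ℝ)) = 0 from rfl, h0, mul_zero] at this
    exact hd this
  have ha0 : ∀ j < n + 1, a j 0 = 0 := by
    intro j hj
    have := (hcoef j hj).self_of_nhds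
    rw [hlow j hj] at this
    exact (mul_eq_zero.1 this.symm).resolve_left (by positivity)
  have han : ∀ᶠ x in 𝓝 (0 : Fin m → ℝ), a n x = 0 := by
    filter_upwards [hcoef n (by omega), hn] with x h1 h2
    rw [h2] at h1
    exact (mul_eq_zero.1 h1.symm).resolve_left (by positivity)
  have hfst : Tendsto (fun z : (Fin m → ℝ) × ℝ => z.1) (𝓝 0) (𝓝 0) := continuous_fst.tendsto _
  have hexp' : ∀ᶠ z in 𝓝 (0 : (Fin m → ℝ) × ℝ),
      f z = ∑ i ∈ Finset.range n, a i z.1 * z.2 ^ i + z.2 ^ (n+1) * u z := by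
    filter_upwards [hexp, hfst.eventually han] with z h1 h2
    rw [h1, Finset.sum_range_succ, h2, zero_mul, add_zero]
  let N := (n+1).factorial
  let M : ℕ → ℕ := fun i => N / (n + 1 - i)
  have hMN : ∀ i < n, (n+1-i) * M i = N := fun i hi =>
    Nat.mul_div_cancel' (Nat.dvd_factorial (by omega) (by omega))
  have hN0 : N ≠ 0 := Nat.factorial_ne_zero _
  let S := (Finset.range n).filter fun i => ¬ ∀ᶠ x in 𝓝 (0 : Fin m → ℝ), a i x = 0
  let D : ℕ × ℕ → (Fin m → ℝ) → ℝ := fun ij x => a ij.1 x ^ (2 * M ij.1) - a ij.2 x ^ (2 * M ij.2)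
  have hD : ∀ ij, AnalyticAt ℝ (D ij) 0 := fun ij =>
    ((ha ij.1).fun_pow _).fun_sub ((ha ij.2).fun_pow _)
  let T := (S ×ˢ S).filter fun ij => ¬ ∀ᶠ x in 𝓝 (0 : Fin m → ℝ), D ij x = 0
  have hx0 : Tendsto (fun n => (p n).1) 𝒰 (𝓝 0) := (continuous_fst.tendsto _).comp hp
  have hPa : AnalyticAt ℝ (fun x => ∏ i ∈ S, a i x) 0 := Finset.analyticAt_fun_prod _ fun i _ => ha i
  have hPD : AnalyticAt ℝ (fun x => ∏ ij ∈ T, D ij x) 0 := Finset.analyticAt_fun_prod _ fun i _ => hD i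
  obtain ⟨s, r, hL, hNC⟩ := hM 𝒰 (fun x => (h x * ∏ i ∈ S, a i x) * ∏ ij ∈ T, D ij x)
    (fun n => (p n).1) ((hh.fun_mul hPa).fun_mul hPD)
    (germ_mul_ne (hh.fun_mul hPa) hPD (germ_mul_ne hh hPa hh0
      (germ_prod_ne S a (fun i _ => ha i) fun i hi => (Finset.mem_filter.1 hi).2))
      (germ_prod_ne T D (fun i _ => hD i) fun i hi => (Finset.mem_filter.1 hi).2)) hx0
  obtain ⟨hNC1, hNC2⟩ := NC.factor (hL.analytic (hh.fun_mul hPa)) (hL.analytic hPD) hNC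
  obtain ⟨hNCh, hNCa⟩ := NC.factor (hL.analytic hh) (hL.analytic hPa) hNC1
  have hNCa' := NC.factor_prod S (fun i z => a i (s z)) (fun i _ => hL.analytic (ha i)) hNCa
  have hNCD := NC.factor_prod T (fun i z => D i (s z)) (fun i _ => hL.analytic (hD i)) hNC2
  by_cases hS : S.Nonempty
  swap
  · have hall : ∀ i < n, ∀ᶠ x in 𝓝 (0 : Fin m → ℝ), a i x = 0 := by
      intro i hi
      by_contra hcon
      exact hS ⟨i, Finset.mem_filter.2 ⟨Finset.mem_range.2 hi, hcon⟩⟩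
    have hall' : ∀ᶠ x in 𝓝 (0 : Fin m → ℝ), ∀ i ∈ Finset.range n, a i x = 0 :=
      (eventually_all_finset _).2 fun i hi => hall i (Finset.mem_range.1 hi)
    have hLe := hL.extend hp
    refine Res.pull hLe ?_
    refine Res.spl (d := n+1) hLe.2.2.1 hNCh (hLe.analytic hu) (hLe.ne hu0) ?_
    filter_upwards [hLe.tendsto.eventually hexp',
      hLe.tendsto.eventually (hfst.eventually hall')] with z h1 h2
    rw [h1, Finset.sum_eq_zero, zero_add]
    intro i hi
    rw [h2 i hi, zero_mul]
  have hα : ∀ i, ∃ α : Fin m → ℕ, i ∈ S → NCw α (fun z => a i (s z)) := by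
    intro i
    by_cases hi : i ∈ S
    · obtain ⟨α, hα⟩ := hNCa' i hi
      exact ⟨α, fun _ => hα⟩
    · exact ⟨0, fun h => absurd h hi⟩
  choose α hα using hα
  have hcomp : ∀ i ∈ S, ∀ j ∈ S, M i • α i ≤ M j • α j ∨ M j • α j ≤ M i • α i := by
    intro i hi j hj
    obtain ⟨v, hv, hv0, e1⟩ := (hα i hi).pow (2 * M i)
    obtain ⟨v1, hv1, hv10, e1'⟩ := hα i hi
    obtain ⟨v2, hv2, hv20, e2'⟩ := hα j hj
    have hcmp := mono_compare (α := (2 * M i) • α i) (β := (2 * M j) • α j)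
      (u := fun z => v1 z ^ (2 * M i)) (v := fun z => v2 z ^ (2 * M j))
      (hv1.fun_pow _).continuousAt (hv2.fun_pow _).continuousAt
      (by rw [pow_mul]; exact pow_pos (by positivity) _)
      (by rw [pow_mul]; exact pow_pos (by positivity) _) (by
        have hDe : ∀ᶠ z in 𝓝 (0 : Fin m → ℝ), mono ((2 * M i) • α i) z * v1 z ^ (2 * M i) -
            mono ((2 * M j) • α j) z * v2 z ^ (2 * M j) = D (i, j) (s z) := by
          filter_upwards [e1', e2'] with z h1 h2
          simp only [D]
          rw [h1, h2, mul_pow, mul_pow, mono_smul, mono_smul]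
        by_cases hz : ∀ᶠ x in 𝓝 (0 : Fin m → ℝ), D (i, j) x = 0
        · left
          filter_upwards [hDe, hL.tendsto.eventually hz] with z h1 h2
          rw [h1, h2]
        · right
          exact (hNCD (i, j) (Finset.mem_filter.2 ⟨Finset.mk_mem_product hi hj, hz⟩)).congr hDe)
    have hconv : ∀ x y : Fin m → ℕ, ∀ k l : ℕ, (2 * k) • x ≤ (2 * l) • y → k • x ≤ l • y := by
      intro x y k l hxy t
      have := hxy t
      simp only [Pi.smul_apply, smul_eq_mul] at this ⊢
      rw [mul_assoc, mul_assoc] at this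
      omega
    exact hcmp.imp (hconv _ _ _ _) (hconv _ _ _ _)
  obtain ⟨i0, hi0⟩ := S.exists_minimalFor (fun i => M i • α i) hS
  have hi0S : i0 ∈ S := hi0.1
  have hmin : ∀ i ∈ S, M i0 • α i0 ≤ M i • α i := fun i hi =>
    (hcomp i0 hi0S i hi).elim id fun h => hi0.2 hi h
  have hi0n : i0 < n := Finset.mem_range.1 (Finset.mem_filter.1 hi0S).1
  obtain ⟨s2, r2, hL2, hs2⟩ := pow_lift hN0 hL.2.2.1
  let ρ := M i0 • α i0
  have hρ : ρ ≠ 0 := by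
    intro h0
    have hMi : M i0 ≠ 0 := by
      intro h1; have := hMN i0 hi0n; rw [h1, mul_zero] at this; exact hN0 this.symm
    have hα0 : α i0 = 0 := by
      funext t
      have := congrFun h0 t
      simp only [ρ, Pi.smul_apply, smul_eq_mul, Pi.zero_apply, mul_eq_zero] at this
      exact this.resolve_left hMi
    obtain ⟨v, hv, hv0, e⟩ := hα i0 hi0S
    have := e.self_of_nhds
    simp only at this
    rw [hL.2.1, ha0 i0 (by omega), hα0, mono_zero, one_mul] at this
    exact hv0 this.symm
  have hLL := hL.comp hL2
  have key : ∀ i, ∃ b : (Fin m → ℝ) → ℝ, AnalyticAt ℝ b 0 ∧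
      (i < n → ∀ᶠ x in 𝓝 (0 : Fin m → ℝ), a i (s (s2 x)) = mono ((n+1-i) • ρ) x * b x) ∧
      (i = i0 → b 0 ≠ 0) := by
    intro i
    by_cases hi : i ∈ S
    · have hin : i < n := Finset.mem_range.1 (Finset.mem_filter.1 hi).1
      obtain ⟨v, hv, hv0, e⟩ := hs2 _ _ (hα i hi)
      let β : Fin m → ℕ := fun t => (M i • α i) t - ρ t
      have hβ : M i • α i = ρ + β := by
        funext t
        have := hmin i hi t
        exact (Nat.add_sub_cancel' this).symm
      have hexpo : N • α i = (n+1-i) • ρ + (n+1-i) • β := by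
        rw [← smul_add, ← hβ, smul_smul, hMN i hin]
      refine ⟨fun x => mono ((n+1-i) • β) x * v x, (mono_analytic _ _).fun_mul hv, fun _ => ?_, ?_⟩
      · filter_upwards [e] with x hx
        rw [hx, hexpo, mono_add, mul_assoc]
      · intro hii
        subst hii
        have : β = 0 := by funext t; simp [β, ρ]
        simpa [this, mono_zero] using hv0
    · refine ⟨fun _ => 0, analyticAt_const, fun hin => ?_, fun hii => absurd (hii ▸ hi0S) hi⟩
      have hz : ∀ᶠ x in 𝓝 (0 : Fin m → ℝ), a i x = 0 := by
        by_contra hcon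
        exact hi (Finset.mem_filter.2 ⟨Finset.mem_range.2 hin, hcon⟩)
      filter_upwards [hLL.tendsto.eventually hz] with x hx
      rw [hx, mul_zero]
  choose b hb hab hb0 using key
  have hLe := hLL.extend hp
  refine Res.pull hLe ?_
  have hNCh2 : NC (fun z => h (s (s2 z))) := by
    obtain ⟨γ, hγ⟩ := hNCh
    exact ⟨_, hs2 _ _ hγ⟩
  refine (V_step IH 𝒰 hρ b hb (fun z => u (s (s2 z.1), z.2)) (hLe.analytic hu)
    (hLe.ne hu0)
    (fun z => h (s (s2 z))) (hLL.analytic hh) hNCh2 hi0n (hb0 i0 rfl) _ hLe.2.2.1).congr ?_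
  have hall : ∀ᶠ x in 𝓝 (0 : Fin m → ℝ), ∀ i ∈ Finset.range n,
      a i (s (s2 x)) = mono ((n+1-i) • ρ) x * b i x :=
    (eventually_all_finset _).2 fun i hi => hab i (Finset.mem_range.1 hi)
  filter_upwards [hLe.tendsto.eventually hexp', hfst.eventually hall] with z h1 h2
  rw [h1]
  congr 2
  refine Finset.sum_congr rfl fun i hi => ?_
  rw [h2 i hi]

theorem V_main {m : ℕ} (hM : Mon m) (d : ℕ) : VP m d := by
  induction d using Nat.strong_induction_on with
  | _ d IH =>
    intro 𝒰 f h p hf hh hd hh0 hp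
    have hx0 : Tendsto (fun n => (p n).1) 𝒰 (𝓝 0) := (continuous_fst.tendsto _).comp hp
    rcases d with _ | n
    · obtain ⟨s, q, hL, hN⟩ := hM 𝒰 h _ hh hh0 hx0
      have hLe := hL.extend hp
      refine Res.pull hLe (Res.spl (d := 0) hLe.2.2.1 hN (hLe.analytic hf) ?_ ?_)
      · refine hLe.ne ?_
        rw [iteratedDeriv_zero] at hd; exact hd
      · simp
    by_cases hlow : ∃ j < n + 1, iteratedDeriv j (fun s => f (0, s)) 0 ≠ 0
    · obtain ⟨j, hj, hj0⟩ := hlow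
      exact IH j hj 𝒰 f h p hf hh hj0 hh0 hp
    push Not at hlow
    obtain ⟨φ, hφ, hφ0, hφd⟩ := tschirnhausen hf n (hlow n (by omega)) hd
    have hφt : Tendsto φ (𝓝 0) (𝓝 0) := by simpa [hφ0] using hφ.continuousAt.tendsto
    have hL : Lift 𝒰 (fun z : (Fin m → ℝ) × ℝ => (z.1, z.2 + φ z.1))
        (fun n => ((p n).1, (p n).2 - φ (p n).1)) p := by
      refine ⟨AnalyticAt.prod analyticAt_fst (analyticAt_snd.fun_add (fst_analytic hφ)),
        by simp [hφ0], Tendsto.prodMk_nhds hx0 ?_, by simp⟩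
      simpa using ((continuous_snd.tendsto _).comp hp).sub (hφt.comp hx0)
    refine Res.pull hL ?_
    have hder : ∀ j x, iteratedDeriv j (fun s => f (x, s + φ x)) 0 =
        iteratedDeriv j (fun s => f (x, s)) (φ x) := by
      intro j x
      rw [iteratedDeriv_comp_add_const j (fun s => f (x, s)) (φ x)]
      simp
    refine V_tsch hM IH 𝒰 (fun z => f (z.1, z.2 + φ z.1)) h _ (hL.analytic hf) hh ?_ ?_ ?_ hh0 hL.2.2.1
    · rw [hder, hφ0]; exact hd
    · intro j hj
      rw [hder, hφ0]; exact hlow j hj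
    · filter_upwards [hφd] with x hx
      rw [hder]; exact hx
end

section
open Filter Topology

theorem Res.of_ne {m : ℕ} {f : (Fin m → ℝ) → ℝ} (hf : AnalyticAt ℝ f 0) (h0 : f 0 ≠ 0)
    {l : Filter ℕ} {p : ℕ → Fin m → ℝ} (hp : Tendsto p l (𝓝 0)) : Res m f l p :=
  ⟨fun z => z, p, ⟨analyticAt_id, rfl, hp, by simp⟩, NC.unit hf h0⟩

theorem Mon_zero : Mon 0 := by
  intro 𝒰 f p hf hne hp
  refine Res.of_ne hf ?_ hp
  intro h0
  refine hne (Eventually.of_forall fun z => ?_)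
  rw [Subsingleton.elim z 0, h0]

theorem exists_equiv {m : ℕ} {v : Fin (m+1) → ℝ} (hv : v ≠ 0) :
    ∃ e : ((Fin m → ℝ) × ℝ) ≃L[ℝ] (Fin (m+1) → ℝ), e (0, 1) = v := by
  have h1 : Module.finrank ℝ ((Fin m → ℝ) × ℝ) = Module.finrank ℝ (Fin (m+1) → ℝ) := by simp
  let e0 := ContinuousLinearEquiv.ofFinrankEq h1
  have h2 : e0 (0, 1) ≠ 0 := by
    intro h
    have := e0.map_eq_zero_iff.1 h
    simp at this
  obtain ⟨A, hA⟩ := SeparatingDual.exists_continuousLinearEquiv_apply_eq (R := ℝ) h2 hv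
  exact ⟨e0.trans A, hA⟩

theorem exists_line {F : Type*} [NormedAddCommGroup F] [NormedSpace ℝ F] {f : F → ℝ}
    (hf : AnalyticAt ℝ f 0) (hne : ¬ ∀ᶠ z in 𝓝 (0:F), f z = 0) (h0 : f 0 = 0) :
    ∃ v : F, v ≠ 0 ∧ ∃ d : ℕ, iteratedDeriv d (fun t : ℝ => f (t • v)) 0 ≠ 0 := by
  obtain ⟨r, hr, hB⟩ := Metric.eventually_nhds_iff_ball.1 hf.eventually_analyticAt
  obtain ⟨v, hv, hfv⟩ : ∃ v ∈ Metric.ball (0:F) r, f v ≠ 0 := by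
    by_contra! hcon
    exact hne (Metric.eventually_nhds_iff_ball.2 ⟨r, hr, hcon⟩)
  refine ⟨v, fun h => hfv (by rw [h, h0]), ?_⟩
  by_contra! hcon
  let L : ℝ →L[ℝ] F := (ContinuousLinearMap.id ℝ ℝ).smulRight v
  have hLa : ∀ t, L t = t • v := fun t => by simp [L]
  let A := L ⁻¹' Metric.ball (0:F) r
  have hA : AnalyticOnNhd ℝ (fun t : ℝ => f (t • v)) A := by
    intro t ht
    have h1 := AnalyticAt.fun_comp (g := f) (f := L) (hB _ ht) (L.analyticAt t)
    simpa only [hLa] using h1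
  have h0A : (0:ℝ) ∈ A := by simp [A, hr]
  have h1A : (1:ℝ) ∈ A := by simpa [A, hLa] using hv
  have hAc : IsPreconnected A :=
    ((convex_ball (0:F) r).linear_preimage (L : ℝ →ₗ[ℝ] F)).isPreconnected
  have htop : analyticOrderAt (fun t : ℝ => f (t • v)) 0 = ⊤ := by
    rw [ENat.eq_top_iff_forall_ge]
    intro n
    rw [natCast_le_analyticOrderAt_iff_iteratedDeriv_eq_zero (hA 0 h0A)]
    intro i _
    exact hcon i
  rw [analyticOrderAt_eq_top] at htop
  have := hA.eqOn_zero_of_preconnected_of_eventuallyEq_zero hAc h0A htop h1A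
  simp at this
  exact hfv this

theorem Mon_succ {m : ℕ} (hM : Mon m) : Mon (m+1) := by
  intro 𝒰 f p hf hne hp
  by_cases h0 : f 0 = 0
  swap
  · exact Res.of_ne hf h0 hp
  obtain ⟨v, hv, d, hd⟩ := exists_line hf hne h0
  obtain ⟨e, he⟩ := exists_equiv hv
  have hL : Lift 𝒰 (fun z => e z) (fun n => e.symm (p n)) p := by
    refine ⟨e.analyticAt 0, by simp, ?_, by simp⟩
    have := (e.symm.continuous.tendsto 0).comp hp
    rw [map_zero] at this
    exact this
  refine Res.pull hL ?_
  have hline : ∀ s : ℝ, e (0, s) = s • v := by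
    intro s
    rw [← he, ← map_smul]
    simp
  refine (V_main hM d 𝒰 (fun z => f (e z)) (fun _ => 1) _ (hL.analytic hf) analyticAt_const ?_ ?_
    hL.2.2.1).congr (by simp)
  · simpa only [hline] using hd
  · exact germ_ne_of_ne one_ne_zero

theorem Mon_all (m : ℕ) : Mon m := by
  induction m with
  | zero => exact Mon_zero
  | succ m ih => exact Mon_succ ih

theorem fderiv_mono {k : ℕ} (α : Fin k → ℕ) (j : Fin k) (z : Fin k → ℝ) :
    fderiv ℝ (mono α) z (Pi.single j (z j)) = α j * mono α z := by
  classical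
  have h1 : HasDerivAt (fun t : ℝ => z + t • (Pi.single j (z j) : Fin k → ℝ))
      (Pi.single j (z j) : Fin k → ℝ) 0 := by
    simpa using ((hasDerivAt_id (0:ℝ)).smul_const (Pi.single j (z j) : Fin k → ℝ)).const_add z
  have h2 := HasFDerivAt.comp_hasDerivAt (0:ℝ) (l := mono α) (l' := fderiv ℝ (mono α) z)
    (f := fun t : ℝ => z + t • (Pi.single j (z j) : Fin k → ℝ))
    (by simpa using (mono_analytic α z).differentiableAt.hasFDerivAt) h1
  have h3 : (mono α ∘ fun t : ℝ => z + t • (Pi.single j (z j) : Fin k → ℝ)) =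
      fun t : ℝ => (1 + t) ^ α j * mono α z := by
    funext t
    simp only [mono, Function.comp]
    rw [← Finset.mul_prod_erase _ _ (Finset.mem_univ j),
      ← Finset.mul_prod_erase _ (fun i => z i ^ α i) (Finset.mem_univ j)]
    rw [← mul_assoc, ← mul_pow]
    congr 1
    · simp; ring
    · refine Finset.prod_congr rfl fun i hi => ?_
      simp [Finset.ne_of_mem_erase hi]
  rw [h3] at h2
  have h4 : HasDerivAt (fun t : ℝ => (1 + t) ^ α j * mono α z) (α j * mono α z) 0 := by
    have := (((hasDerivAt_id (0:ℝ)).const_add 1).fun_pow (α j)).mul_const (mono α z)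
    simpa using this
  exact h2.unique h4

theorem ratio_bound {k : ℕ} {u w : (Fin k → ℝ) → ℝ} (hu : ContinuousAt u 0) (hw : ContinuousAt w 0)
    (hu0 : u 0 ≠ 0) : ∃ K : ℝ, ∀ᶠ z in 𝓝 (0 : Fin k → ℝ), |w z| ≤ K * |u z| := by
  have h := ((hw.div hu hu0).abs).eventually (gt_mem_nhds (lt_add_one _))
  refine ⟨|w 0 / u 0| + 1, ?_⟩
  filter_upwards [h, hu.eventually_ne hu0] with z h1 h2
  simp only [Pi.div_apply, abs_div] at h1 ⊢
  rw [div_lt_iff₀ (abs_pos.2 h2)] at h1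
  exact h1.le

theorem euler_bound {k : ℕ} {α : Fin k → ℕ} {φ : (Fin k → ℝ) → ℝ} (h : NCw α φ) (j : Fin k) :
    (∃ K : ℝ, ∀ᶠ z in 𝓝 (0 : Fin k → ℝ), |fderiv ℝ φ z (Pi.single j (z j))| ≤ K * |φ z|) ∧
    (α j ≠ 0 → ∃ K : ℝ, ∀ᶠ z in 𝓝 (0 : Fin k → ℝ),
      |φ z| ≤ K * |fderiv ℝ φ z (Pi.single j (z j))|) := by
  obtain ⟨u, hu, hu0, h⟩ := h
  let w : (Fin k → ℝ) → ℝ := fun z => α j * u z + fderiv ℝ u z (Pi.single j (z j))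
  have hw : ContinuousAt w 0 := by
    refine (continuousAt_const.mul hu.continuousAt).add ?_
    refine hu.fderiv.continuousAt.clm_apply ?_
    have : Continuous (fun z : Fin k → ℝ => (Pi.single j (z j) : Fin k → ℝ)) :=
      (continuous_single j).comp (continuous_apply j)
    exact this.continuousAt
  have hw0 : w 0 = α j * u 0 := by simp [w]
  have hd : ∀ᶠ z in 𝓝 (0 : Fin k → ℝ), fderiv ℝ φ z (Pi.single j (z j)) = mono α z * w z := by
    filter_upwards [h.eventually_nhds, hu.eventually_analyticAt] with z h1 h2
    rw [EventuallyEq.fderiv_eq h1, fderiv_fun_mul (mono_analytic α z).differentiableAt h2.differentiableAt]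
    simp only [add_apply, smul_apply, smul_eq_mul]
    rw [fderiv_mono]
    simp only [w]
    ring
  constructor
  · obtain ⟨K, hK⟩ := ratio_bound hu.continuousAt hw hu0
    refine ⟨K, ?_⟩
    filter_upwards [hK, h, hd] with z h1 h2 h3
    rw [h2, h3, abs_mul, abs_mul]
    nlinarith [abs_nonneg (mono α z), mul_le_mul_of_nonneg_left h1 (abs_nonneg (mono α z))]
  · intro hj
    obtain ⟨K, hK⟩ := ratio_bound hw hu.continuousAt (by
      rw [hw0]; exact mul_ne_zero (by exact_mod_cast hj) hu0)
    refine ⟨K, ?_⟩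
    filter_upwards [hK, h, hd] with z h1 h2 h3
    rw [h2, h3, abs_mul, abs_mul]
    nlinarith [abs_nonneg (mono α z), mul_le_mul_of_nonneg_left h1 (abs_nonneg (mono α z))]

theorem core_pi {m : ℕ} {R : (Fin m → ℝ) → ℝ} (hR : AnalyticAt ℝ R 0) (hR0 : R 0 = 0) :
    ∃ C : ℝ, ∀ᶠ x in 𝓝 (0 : Fin m → ℝ), |R x| ≤ C * (‖x‖ * ‖fderiv ℝ R x‖) := by
  by_contra hcon
  have h1 : ∀ n : ℕ, ∃ x : Fin m → ℝ, ‖x‖ < 1 / ((n:ℝ) + 1) ∧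
      (n:ℝ) * (‖x‖ * ‖fderiv ℝ R x‖) < |R x| := by
    intro n
    by_contra! h2
    refine hcon ⟨n, Metric.eventually_nhds_iff_ball.2 ⟨1 / ((n:ℝ) + 1), by positivity, ?_⟩⟩
    intro x hx
    exact h2 x (by simpa using hx)
  choose p hp1 hp2 using h1
  let 𝒰 : Ultrafilter ℕ := hyperfilter ℕ
  have h𝒰 : (𝒰 : Filter ℕ) ≤ atTop := Nat.hyperfilter_le_atTop
  have hp : Tendsto p 𝒰 (𝓝 0) := by
    refine Tendsto.mono_left ?_ h𝒰
    exact squeeze_zero_norm (fun n => (hp1 n).le) tendsto_one_div_add_atTop_nhds_zero_nat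
  have hne : ¬ ∀ᶠ z in 𝓝 (0 : Fin m → ℝ), R z = 0 := by
    intro h
    obtain ⟨n, hn⟩ := (hp.eventually h).exists
    have := hp2 n
    rw [hn, abs_zero] at this
    exact absurd this (not_lt.2 (by positivity))
  have hPa : AnalyticAt ℝ (fun x : Fin m → ℝ => ∏ i, x i) 0 :=
    Finset.analyticAt_fun_prod _ fun i _ => analyticAt_coord i 0
  obtain ⟨s, q, hL, hN⟩ := Mon_all m 𝒰 (fun x => R x * ∏ i, x i) p (hR.fun_mul hPa)
    (germ_mul_ne hR hPa hne (germ_prod_ne Finset.univ (fun i (x : Fin m → ℝ) => x i)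
      (fun i _ => analyticAt_coord i 0) fun i _ => coord_ne i)) hp
  obtain ⟨⟨α, hα⟩, hN2⟩ := NC.factor (hL.analytic hR) (hL.analytic hPa) hN
  have hN3 := NC.factor_prod Finset.univ (fun i z => s z i)
    (fun i _ => hL.analytic (analyticAt_coord i 0)) hN2
  obtain ⟨j, hj⟩ : ∃ j, α j ≠ 0 := by
    by_contra! h
    have hα0 : α = 0 := funext h
    obtain ⟨v, hv, hv0, e⟩ := hα
    have := e.self_of_nhds
    simp only at this
    rw [hL.2.1, hR0, hα0, mono_zero, one_mul] at this
    exact hv0 this.symm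
  obtain ⟨K, hK⟩ := (euler_bound hα j).2 hj
  have hKi : ∀ i, ∃ K : ℝ, ∀ᶠ z in 𝓝 (0 : Fin m → ℝ),
      |fderiv ℝ (fun z => s z i) z (Pi.single j (z j))| ≤ K * |s z i| := by
    intro i
    obtain ⟨β, hβ⟩ := hN3 i (Finset.mem_univ i)
    exact (euler_bound hβ j).1
  choose Ki hKi using hKi
  let K2 : ℝ := ∑ i, |Ki i|
  have hfin : ∀ᶠ z in 𝓝 (0 : Fin m → ℝ), |R (s z)| ≤ |K| * (K2 * (‖s z‖ * ‖fderiv ℝ R (s z)‖)) := by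
    filter_upwards [hK, eventually_all.2 hKi, hL.1.eventually_analyticAt,
      hL.tendsto.eventually hR.eventually_analyticAt] with z e1 e2 e3 e4
    have hchain : fderiv ℝ (fun z => R (s z)) z (Pi.single j (z j)) =
        fderiv ℝ R (s z) (fderiv ℝ s z (Pi.single j (z j))) := by
      rw [fderiv_fun_comp z e4.differentiableAt e3.differentiableAt]
      rfl
    have hcoord : ‖fderiv ℝ s z (Pi.single j (z j))‖ ≤ K2 * ‖s z‖ := by
      rw [pi_norm_le_iff_of_nonneg (by positivity)]
      intro i
      have h5 : fderiv ℝ s z (Pi.single j (z j)) i = fderiv ℝ (fun z => s z i) z (Pi.single j (z j)) := by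
        have := (hasFDerivAt_pi'.1 e3.differentiableAt.hasFDerivAt i).fderiv
        rw [this]; rfl
      rw [h5, Real.norm_eq_abs]
      refine (e2 i).trans ?_
      have h6 : |s z i| ≤ ‖s z‖ := norm_le_pi_norm (s z) i
      have h7 : Ki i ≤ K2 := (le_abs_self _).trans
        (Finset.single_le_sum (f := fun i => |Ki i|) (fun i _ => abs_nonneg _) (Finset.mem_univ i))
      have h8 : 0 ≤ K2 := Finset.sum_nonneg fun i _ => abs_nonneg _
      exact mul_le_mul h7 h6 (abs_nonneg _) h8
    rw [hchain] at e1
    refine e1.trans ?_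
    refine mul_le_mul (le_abs_self K) ?_ (abs_nonneg _) (abs_nonneg _)
    refine ((fderiv ℝ R (s z)).le_opNorm _).trans ?_
    calc _ ≤ ‖fderiv ℝ R (s z)‖ * (K2 * ‖s z‖) := by gcongr
      _ = _ := by ring
  obtain ⟨N, hN⟩ := exists_nat_ge (|K| * K2)
  obtain ⟨n, h1, h2, h3⟩ := ((hL.2.2.1.eventually hfin).and
    (hL.2.2.2.and ((eventually_ge_atTop N).filter_mono h𝒰))).exists
  have h4 := hp2 n
  rw [h2] at h1
  have h5 : |K| * K2 ≤ n := hN.trans (by exact_mod_cast h3)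
  have h6 : |K| * K2 * (‖p n‖ * ‖fderiv ℝ R (p n)‖) ≤ n * (‖p n‖ * ‖fderiv ℝ R (p n)‖) := by
    gcongr
  linarith

theorem core {m : ℕ} {R : EuclideanSpace ℝ (Fin m) → ℝ} (hR : AnalyticAt ℝ R 0) (hR0 : R 0 = 0) :
    ∃ C : ℝ, 0 ≤ C ∧ ∀ᶠ x in 𝓝 (0 : EuclideanSpace ℝ (Fin m)),
      |R x| ≤ C * (‖x‖ * ‖fderiv ℝ R x‖) := by
  let e : (Fin m → ℝ) ≃L[ℝ] EuclideanSpace ℝ (Fin m) := (EuclideanSpace.equiv (Fin m) ℝ).symm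
  have hRe : AnalyticAt ℝ (fun z => R (e z)) 0 :=
    AnalyticAt.fun_comp (g := R) (f := e) (by rw [map_zero]; exact hR) (e.analyticAt 0)
  obtain ⟨C, hC⟩ := core_pi hRe (by rw [map_zero, hR0])
  have ht : Tendsto e.symm (𝓝 0) (𝓝 0) := by simpa using e.symm.continuous.tendsto 0
  let A : ℝ := ‖(e.symm : EuclideanSpace ℝ (Fin m) →L[ℝ] (Fin m → ℝ))‖
  let B : ℝ := ‖(e : (Fin m → ℝ) →L[ℝ] EuclideanSpace ℝ (Fin m))‖
  refine ⟨|C| * (A * B), by positivity, ?_⟩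
  filter_upwards [ht.eventually hC] with x hx
  simp only [e.apply_symm_apply] at hx
  refine hx.trans ?_
  have h1 : ‖e.symm x‖ ≤ A * ‖x‖ :=
    (e.symm : EuclideanSpace ℝ (Fin m) →L[ℝ] (Fin m → ℝ)).le_opNorm x
  have h2 : ‖fderiv ℝ (fun z => R (e z)) (e.symm x)‖ ≤ ‖fderiv ℝ R x‖ * B := by
    have := e.comp_right_fderiv (f := R) (x := e.symm x)
    rw [show (fun z => R (e z)) = R ∘ e from rfl, this, e.apply_symm_apply]
    exact ContinuousLinearMap.opNorm_comp_le _ _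
  calc C * (‖e.symm x‖ * ‖fderiv ℝ (fun z => R (e z)) (e.symm x)‖)
      ≤ |C| * ((A * ‖x‖) * (‖fderiv ℝ R x‖ * B)) := by
        gcongr
        exact le_abs_self C
    _ = _ := by ring
end

section
open Filter Topology
open scoped ContDiff

theorem H_expand {m n : ℕ} (M : ContinuousMultilinearMap ℝ (fun _ : Fin n => EuclideanSpace ℝ (Fin m)) ℝ)
    (v : Fin n → EuclideanSpace ℝ (Fin m)) :
    M v = ∑ ι : Fin n → Fin m, (∏ l, v l (ι l)) * M (fun l => EuclideanSpace.single (ι l) (1:ℝ)) := by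
  have hv : v = fun l => ∑ i, (v l i) • EuclideanSpace.single i (1:ℝ) := by
    funext l
    ext j
    simp [Finset.sum_apply, Pi.single_apply]
  conv_lhs => rw [hv]
  rw [ContinuousMultilinearMap.map_sum]
  refine Finset.sum_congr rfl fun ι _ => ?_
  rw [ContinuousMultilinearMap.map_smul_univ]
  rfl

theorem H_norm_le {m n : ℕ} (M : ContinuousMultilinearMap ℝ (fun _ : Fin n => EuclideanSpace ℝ (Fin m)) ℝ) :
    ‖M‖ ≤ Real.sqrt (∑ ι : Fin n → Fin m, (M (fun l => EuclideanSpace.single (ι l) (1:ℝ))) ^ 2) := by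
  refine ContinuousMultilinearMap.opNorm_le_bound (Real.sqrt_nonneg _) fun v => ?_
  rw [H_expand M v, Real.norm_eq_abs]
  have h2 : ∏ l, ‖v l‖ = Real.sqrt (∑ ι : Fin n → Fin m, (∏ l, v l (ι l)) ^ 2) := by
    symm
    rw [Real.sqrt_eq_iff_mul_self_eq (Finset.sum_nonneg fun _ _ => sq_nonneg _)
      (Finset.prod_nonneg fun _ _ => norm_nonneg _)]
    rw [← sq, ← Finset.prod_pow]
    simp_rw [EuclideanSpace.real_norm_sq_eq]
    rw [Finset.prod_univ_sum, Fintype.piFinset_univ]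
    simp_rw [Finset.prod_pow]
  rw [h2, mul_comm, ← Real.sqrt_mul (Finset.sum_nonneg fun _ _ => sq_nonneg _)]
  exact Real.abs_le_sqrt (Finset.sum_mul_sq_le_sq_mul_sq _ _ _)

theorem H_iter {m : ℕ} {f : EuclideanSpace ℝ (Fin m) → ℝ} {x : EuclideanSpace ℝ (Fin m)}
    (hf : AnalyticAt ℝ f x) (j : ℕ) : AnalyticAt ℝ (iteratedFDeriv ℝ j f) x :=
  AnalyticOnNhd.iteratedFDeriv (s := {y | AnalyticAt ℝ f y}) (fun _ hy => hy) j x hf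

theorem H_T_deriv {m : ℕ} {f : EuclideanSpace ℝ (Fin m) → ℝ} {x : EuclideanSpace ℝ (Fin m)}
    (hf : AnalyticAt ℝ f x) (j : ℕ) :
    ∃ L : EuclideanSpace ℝ (Fin m) →L[ℝ] ℝ,
      HasFDerivAt (fun y => iteratedFDeriv ℝ j f y (fun _ => y)) L x ∧
      ∀ v, L v = iteratedFDeriv ℝ (j+1) f x (Fin.cons v (fun _ => x)) +
        ∑ i, iteratedFDeriv ℝ j f x (Function.update (fun _ => x) i v) := by
  have hd : DifferentiableAt ℝ (iteratedFDeriv ℝ j f) x :=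
    (H_iter hf j).differentiableAt
  refine ⟨_, HasFDerivAt.continuousMultilinearMap_apply hd.hasFDerivAt
    (g := fun _ y => y) (fun _ => hasFDerivAt_id x), fun v => ?_⟩
  simp [iteratedFDeriv_succ_apply_left]

theorem H_sym {m : ℕ} {f : EuclideanSpace ℝ (Fin m) → ℝ} {x : EuclideanSpace ℝ (Fin m)}
    (hf : AnalyticAt ℝ f x) (j : ℕ) (i : Fin (j+1)) (v : EuclideanSpace ℝ (Fin m)) :
    iteratedFDeriv ℝ (j+1) f x (Function.update (fun _ => x) i v) =
      iteratedFDeriv ℝ (j+1) f x (Fin.cons v (fun _ => x)) := by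
  rw [← ContDiffAt.iteratedFDeriv_comp_perm (hf.contDiffAt) (Fin.cons v (fun _ => x)) (Equiv.swap 0 i)]
  congr 1
  funext l
  by_cases hl : l = i
  · subst hl; simp
  · rw [Function.update_of_ne hl, Function.comp]
    have : Equiv.swap 0 i l ≠ 0 := by
      intro h
      apply hl
      have := congrArg (Equiv.swap 0 i) h
      simpa using this
    obtain ⟨p, hp⟩ := Fin.exists_succ_eq.mpr this
    rw [← hp, Fin.cons_succ]

theorem H_S_deriv {m : ℕ} {f : EuclideanSpace ℝ (Fin m) → ℝ} {x : EuclideanSpace ℝ (Fin m)}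
    (hf : AnalyticAt ℝ f x) (k : ℕ) :
    ∃ L : EuclideanSpace ℝ (Fin m) →L[ℝ] ℝ,
      HasFDerivAt (fun y => ∑ j ∈ Finset.range (k+1), ((-1 : ℝ) ^ j / (Nat.factorial j : ℝ)) *
        iteratedFDeriv ℝ j f y (fun _ => y)) L x ∧
      ∀ v, L v = ((-1 : ℝ) ^ k / (Nat.factorial k : ℝ)) *
        iteratedFDeriv ℝ (k+1) f x (Fin.cons v (fun _ => x)) := by
  induction k with
  | zero =>
    obtain ⟨L, hL, hv⟩ := H_T_deriv hf 0
    refine ⟨L, by simpa using hL, fun v => ?_⟩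
    rw [hv]; simp
  | succ k ih =>
    obtain ⟨L1, h1, hv1⟩ := ih
    obtain ⟨L, hL, hv⟩ := H_T_deriv hf (k+1)
    refine ⟨L1 + ((-1 : ℝ) ^ (k+1) / (Nat.factorial (k+1) : ℝ)) • L, ?_, fun v => ?_⟩
    · simp_rw [Finset.sum_range_succ _ (k+1)]
      exact h1.add (hL.const_mul _)
    · rw [ContinuousLinearMap.add_apply, ContinuousLinearMap.smul_apply, hv1, hv]
      simp_rw [H_sym hf k]
      rw [Finset.sum_const, Finset.card_univ, Fintype.card_fin, Nat.factorial_succ]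
      have : (Nat.factorial k : ℝ) ≠ 0 := by positivity
      have h3 : (k : ℝ) + 1 ≠ 0 := by positivity
      push_cast
      simp only [smul_eq_mul, nsmul_eq_mul]
      push_cast
      field_simp
      ring

theorem H_T_analytic {m : ℕ} {f : EuclideanSpace ℝ (Fin m) → ℝ} {x : EuclideanSpace ℝ (Fin m)}
    (hf : AnalyticAt ℝ f x) (j : ℕ) :
    AnalyticAt ℝ (fun y => iteratedFDeriv ℝ j f y (fun _ => y)) x := by
  have h1 := ContinuousLinearMap.analyticAt_uncurry_of_multilinear
    (ContinuousLinearMap.id ℝ (ContinuousMultilinearMap ℝ (fun _ : Fin j => EuclideanSpace ℝ (Fin m)) ℝ))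
    (x := (iteratedFDeriv ℝ j f x, fun _ => x))
  have h2 : AnalyticAt ℝ (fun y => (iteratedFDeriv ℝ j f y, (fun _ : Fin j => y))) x :=
    (H_iter hf j).prod (AnalyticAt.pi fun _ => analyticAt_id)
  exact AnalyticAt.fun_comp (f := fun y => (iteratedFDeriv ℝ j f y, (fun _ : Fin j => y))) h1 h2

theorem H_main
    (m k : ℕ) (U : Set (EuclideanSpace ℝ (Fin m))) (hU : IsOpen U)
    (h0 : (0 : EuclideanSpace ℝ (Fin m)) ∈ U)
    (f : EuclideanSpace ℝ (Fin m) → ℝ) (hf : AnalyticOnNhd ℝ f U) :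
    ∃ (V : Set (EuclideanSpace ℝ (Fin m))) (C : ℝ),
      IsOpen V ∧ (0 : EuclideanSpace ℝ (Fin m)) ∈ V ∧ V ⊆ U ∧ 0 ≤ C ∧
      ∀ x ∈ V,
        |f 0 - ∑ j ∈ Finset.range (k + 1), ∑ ι : Fin j → Fin m,
            ((-1 : ℝ) ^ j / (Nat.factorial j : ℝ)) * (∏ l, x (ι l)) *
              (iteratedFDerivWithin ℝ j f U x)
                (fun l => EuclideanSpace.single (ι l) (1:ℝ))|
          ≤ C * (∑ i, x i ^ 2) ^ (((k : ℝ) + 1) / 2) *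
              Real.sqrt (∑ ι : Fin (k + 1) → Fin m,
                ((iteratedFDerivWithin ℝ (k + 1) f U x)
                  (fun l => EuclideanSpace.single (ι l) (1:ℝ))) ^ 2) := by
  set R : EuclideanSpace ℝ (Fin m) → ℝ := fun y => f 0 - ∑ j ∈ Finset.range (k+1),
    ((-1 : ℝ) ^ j / (Nat.factorial j : ℝ)) * iteratedFDeriv ℝ j f y (fun _ => y) with hRdef
  have hR : AnalyticAt ℝ R 0 :=
    analyticAt_const.fun_sub (Finset.analyticAt_fun_sum _ fun j _ =>
      analyticAt_const.fun_mul (H_T_analytic (hf 0 h0) j))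
  have hR0 : R 0 = 0 := by
    simp only [hRdef]
    rw [Finset.sum_range_succ', Finset.sum_eq_zero]
    · simp
    · intro j _
      rw [ContinuousMultilinearMap.map_coord_zero _ (0 : Fin (j+1)) rfl, mul_zero]
  obtain ⟨C, hC, hev⟩ := core hR hR0
  obtain ⟨W, hW, hWo, hW0⟩ := eventually_nhds_iff.mp hev
  refine ⟨W ∩ U, C / Nat.factorial k, hWo.inter hU, ⟨hW0, h0⟩, Set.inter_subset_right,
    by positivity, ?_⟩
  rintro x ⟨hxW, hxU⟩
  have hx := hW x hxW
  simp_rw [iteratedFDerivWithin_of_isOpen _ hU hxU]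
  have e1 : f 0 - ∑ j ∈ Finset.range (k + 1), ∑ ι : Fin j → Fin m,
            ((-1 : ℝ) ^ j / (Nat.factorial j : ℝ)) * (∏ l, x (ι l)) *
              (iteratedFDeriv ℝ j f x) (fun l => EuclideanSpace.single (ι l) (1:ℝ)) = R x := by
    simp only [hRdef]
    congr 1
    refine Finset.sum_congr rfl fun j _ => ?_
    rw [H_expand (iteratedFDeriv ℝ j f x) (fun _ => x), Finset.mul_sum]
    exact Finset.sum_congr rfl fun ι _ => by ring
  rw [e1]
  have e2 : (∑ i, x i ^ 2) ^ (((k : ℝ) + 1) / 2) = ‖x‖ ^ (k+1) := by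
    rw [← EuclideanSpace.real_norm_sq_eq, ← Real.rpow_natCast ‖x‖ 2, ← Real.rpow_mul (norm_nonneg _),
      ← Real.rpow_natCast]
    congr 1
    push_cast
    ring
  rw [e2]
  have hn := H_norm_le (iteratedFDeriv ℝ (k+1) f x)
  set S := Real.sqrt (∑ ι : Fin (k + 1) → Fin m,
                ((iteratedFDeriv ℝ (k + 1) f x)
                  (fun l => EuclideanSpace.single (ι l) (1:ℝ))) ^ 2) with hS
  have hd : ‖fderiv ℝ R x‖ ≤ (1 / Nat.factorial k) * S * ‖x‖ ^ k := by
    obtain ⟨L, hL, hv⟩ := H_S_deriv (hf x hxU) k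
    have hRL : HasFDerivAt R (-L) x := hL.const_sub (f 0)
    rw [hRL.fderiv, norm_neg]
    refine ContinuousLinearMap.opNorm_le_bound _ (by positivity) fun v => ?_
    rw [hv, norm_mul]
    have a1 : ‖((-1 : ℝ) ^ k / (Nat.factorial k : ℝ))‖ = 1 / Nat.factorial k := by
      simp
    have a2 := (iteratedFDeriv ℝ (k+1) f x).le_opNorm (Fin.cons v (fun _ => x))
    rw [Fin.prod_univ_succ] at a2
    simp only [Fin.cons_zero, Fin.cons_succ, Finset.prod_const, Finset.card_univ, Fintype.card_fin] at a2
    rw [a1]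
    calc _ ≤ 1 / (Nat.factorial k : ℝ) * (S * (‖v‖ * ‖x‖ ^ k)) := by
          gcongr
          exact a2.trans (by gcongr)
      _ = _ := by ring
  calc |R x| ≤ C * (‖x‖ * ‖fderiv ℝ R x‖) := hx
    _ ≤ C * (‖x‖ * ((1 / Nat.factorial k) * S * ‖x‖ ^ k)) := by gcongr
    _ = _ := by ring
end

end ReversedTaylor

/-- Real analytic "reversed Taylor" theorem: if `f` is real analytic near `0`
in `ℝ^m` and `k ≥ 0`, then on some neighbourhood `V` of `0` the value `f(0)` is approximated
by the order-`k` Taylor polynomial based at the variable point `x` and evaluated at `0`, with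
remainder bounded by `C·|x|^{k+1}` times the Euclidean norm of the `(k+1)`-st derivative
tensor of `f` at `x`. -/
theorem analytic_reversed_taylor
    (m k : ℕ) (U : Set (EuclideanSpace ℝ (Fin m))) (hU : IsOpen U)
    (h0 : (0 : EuclideanSpace ℝ (Fin m)) ∈ U)
    (f : EuclideanSpace ℝ (Fin m) → ℝ) (hf : AnalyticOnNhd ℝ f U) :
    ∃ (V : Set (EuclideanSpace ℝ (Fin m))) (C : ℝ),
      IsOpen V ∧ (0 : EuclideanSpace ℝ (Fin m)) ∈ V ∧ V ⊆ U ∧ 0 ≤ C ∧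
      ∀ x ∈ V,
        |f 0 - ∑ j ∈ Finset.range (k + 1), ∑ ι : Fin j → Fin m,
            ((-1 : ℝ) ^ j / (Nat.factorial j : ℝ)) * (∏ l, x (ι l)) *
              (iteratedFDerivWithin ℝ j f U x)
                (fun l => EuclideanSpace.single (ι l) (1:ℝ))|
          ≤ C * (∑ i, x i ^ 2) ^ (((k : ℝ) + 1) / 2) *
              Real.sqrt (∑ ι : Fin (k + 1) → Fin m,
                ((iteratedFDerivWithin ℝ (k + 1) f U x)
                  (fun l => EuclideanSpace.single (ι l) (1:ℝ))) ^ 2) := by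
  exact ReversedTaylor.H_main m k U hU h0 f hf
end
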